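/- arXiv:2108.08917 — 2 statements merged into one kernel-verified Lean document; each statement's English description precedes it below -/
import Mathlib

section
/- Let n ≥ 4 and let B ⊂ ℂ^{n+1} be a complex symmetric convex body with center at the origin. Suppose that for every n-dimensional complex linear subspace H of ℂ^{n+1}, the section B ∩ H is a complex affine body of revolution (inside H). Then there exists an n-dimensional complex linear subspace H₀ of ℂ^{n+1} such that B ∩ H₀ is a complex ellipsoid. -/
open Metric
open scoped ComplexInnerProductSpace

/-- A set `K` in a complex inner product space is complex symmetric with center at the
origin if `ξ • K = K` for every unit complex number `ξ`. -/
def IsComplexSymmetric {E : Type*} [NormedAddCommGroup E] [InnerProductSpace ℂ E]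
    (K : Set E) : Prop :=
  ∀ ξ : ℂ, ‖ξ‖ = 1 → (fun x => ξ • x) '' K = K

/-- A complex body of revolution: a complex symmetric convex body `K` admitting a complex
axis of revolution spanned by a unit vector `u`. -/
def IsComplexBodyOfRevolution {E : Type*} [NormedAddCommGroup E] [InnerProductSpace ℂ E]
    (K : Set E) : Prop :=
  IsCompact K ∧ Convex ℝ K ∧ (interior K).Nonempty ∧ IsComplexSymmetric K ∧
  ∃ u : E, ‖u‖ = 1 ∧ ∀ z : ℂ,
    K ∩ {x | ⟪u, x⟫ = z} = ∅ ∨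
    (∃ x, K ∩ {x | ⟪u, x⟫ = z} = {x}) ∨
    (∃ r : ℝ, 0 < r ∧
      K ∩ {x | ⟪u, x⟫ = z} = {x | ⟪u, x⟫ = z ∧ dist x (z • u) ≤ r})

/-- A complex affine body of revolution: the image of a complex body of revolution under
a bijective `ℂ`-affine map. -/
def IsComplexAffineBodyOfRevolution {E : Type*} [NormedAddCommGroup E]
    [InnerProductSpace ℂ E] (K : Set E) : Prop :=
  ∃ (g : E ≃ᵃ[ℂ] E) (K₀ : Set E), IsComplexBodyOfRevolution K₀ ∧ K = g '' K₀

/-- A complex ellipsoid: the image of the closed Euclidean unit ball under a bijective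
`ℂ`-affine map. -/
def IsComplexEllipsoid {E : Type*} [NormedAddCommGroup E] [InnerProductSpace ℂ E]
    (K : Set E) : Prop :=
  ∃ g : E ≃ᵃ[ℂ] E, K = g '' closedBall (0 : E) 1

theorem normSq_cross_eq_conj_of_forall {κ κ' : ℂ}
    (h : ∀ b : ℂ, 1 + ‖b + κ‖ ^ 2 - ‖κ‖ ^ 2 = ‖b‖ ^ 2 + ‖1 + κ' * b‖ ^ 2 - ‖κ' * b‖ ^ 2) :
    κ' = star κ := by
  have h1 := h 1
  have h2 := h Complex.I
  simp only [← Complex.normSq_eq_norm_sq, Complex.normSq_apply] at h1 h2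
  simp at h1 h2
  apply Complex.ext
  · simp; linarith
  · simp; linarith

section TwoPlane

variable {V : Type*} [NormedAddCommGroup V] [NormedSpace ℂ V]

/-- The norm in the span of `z₁`, `z₂`, `w`, under two rotational symmetries. -/
theorem two_plane_cross_coeff {z₁ z₂ w : V} {κ κ' : ℂ}
    (A1 : ∀ (a : ℂ) (t : ℝ), ‖a • z₁ + (t : ℂ) • w‖ ^ 2 = ‖a‖ ^ 2 + t ^ 2)
    (A2 : ∀ (b : ℂ) (t : ℝ), ‖b • z₂ + (t : ℂ) • w‖ ^ 2 = ‖b‖ ^ 2 + t ^ 2)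
    (F1 : ∀ (a b b' : ℂ) (t t' : ℝ), ‖b + κ * a‖ ^ 2 + t ^ 2 = ‖b' + κ * a‖ ^ 2 + t' ^ 2 →
      ‖a • z₁ + b • z₂ + (t : ℂ) • w‖ = ‖a • z₁ + b' • z₂ + (t' : ℂ) • w‖)
    (F2 : ∀ (a a' b : ℂ) (t t' : ℝ), ‖a + κ' * b‖ ^ 2 + t ^ 2 = ‖a' + κ' * b‖ ^ 2 + t' ^ 2 →
      ‖a • z₁ + b • z₂ + (t : ℂ) • w‖ = ‖a' • z₁ + b • z₂ + (t' : ℂ) • w‖) :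
    κ' = star κ := by
  apply normSq_cross_eq_conj_of_forall
  intro b
  set t : ℝ := ‖κ‖ + ‖κ' * b‖ with ht
  have e1 := F1 1 b 0 t (√(‖b + κ‖ ^ 2 + t ^ 2 - ‖κ‖ ^ 2)) (by
    rw [Real.sq_sqrt]
    · simp
    · nlinarith [norm_nonneg κ, norm_nonneg (κ' * b), sq_nonneg ‖b + κ‖])
  have e2 := F2 1 0 b t (√(‖1 + κ' * b‖ ^ 2 + t ^ 2 - ‖κ' * b‖ ^ 2)) (by
    rw [Real.sq_sqrt]
    · simp
    · nlinarith [norm_nonneg κ, norm_nonneg (κ' * b), sq_nonneg ‖1 + κ' * b‖])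
  have e3 := A1 1 (√(‖b + κ‖ ^ 2 + t ^ 2 - ‖κ‖ ^ 2))
  have e4 := A2 b (√(‖1 + κ' * b‖ ^ 2 + t ^ 2 - ‖κ' * b‖ ^ 2))
  rw [Real.sq_sqrt (by
    nlinarith [norm_nonneg κ, norm_nonneg (κ' * b), sq_nonneg ‖b + κ‖])] at e3
  rw [Real.sq_sqrt (by
    nlinarith [norm_nonneg κ, norm_nonneg (κ' * b), sq_nonneg ‖1 + κ' * b‖])] at e4
  rw [zero_smul, add_zero] at e1
  rw [zero_smul, zero_add] at e2
  rw [← e1, e2, e4] at e3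
  rw [norm_one] at e3
  linarith

theorem two_plane_norm_le_one {z₁ z₂ w : V} {κ : ℂ}
    (A1 : ∀ (a : ℂ) (t : ℝ), ‖a • z₁ + (t : ℂ) • w‖ ^ 2 = ‖a‖ ^ 2 + t ^ 2)
    (F1 : ∀ (a b b' : ℂ) (t t' : ℝ), ‖b + κ * a‖ ^ 2 + t ^ 2 = ‖b' + κ * a‖ ^ 2 + t' ^ 2 →
      ‖a • z₁ + b • z₂ + (t : ℂ) • w‖ = ‖a • z₁ + b' • z₂ + (t' : ℂ) • w‖) :
    ‖κ‖ ≤ 1 := by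
  have key : ∀ t : ℝ, t ^ 2 = ‖κ‖ ^ 2 → ‖z₁ + (-κ) • z₂ + (t : ℂ) • w‖ = 1 := by
    intro t ht
    have := F1 1 (-κ) 0 t 0 (by simp [ht])
    have h2 := A1 1 0
    simp only [one_smul, zero_smul, add_zero, Complex.ofReal_zero] at this h2
    rw [this]
    exact (pow_eq_one_iff_of_nonneg (norm_nonneg z₁) two_ne_zero).1 (by simpa using h2)
  have hw : ‖w‖ = 1 :=
    (pow_eq_one_iff_of_nonneg (norm_nonneg w) two_ne_zero).1 (by simpa using A1 0 1)
  have h1 := key ‖κ‖ rfl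
  have h2 := key (-‖κ‖) (by ring)
  have h3 := norm_sub_le (z₁ + (-κ) • z₂ + ((‖κ‖ : ℝ) : ℂ) • w)
    (z₁ + (-κ) • z₂ + ((-‖κ‖ : ℝ) : ℂ) • w)
  have h4 : (z₁ + (-κ) • z₂ + ((‖κ‖ : ℝ) : ℂ) • w) -
    (z₁ + (-κ) • z₂ + ((-‖κ‖ : ℝ) : ℂ) • w) = ((2 * ‖κ‖ : ℝ) : ℂ) • w := by
    push_cast
    module
  rw [h4, h1, h2, norm_smul, hw, Complex.norm_real, Real.norm_of_nonneg (by positivity)] at h3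
  linarith

theorem two_plane_norm_ne_one {z₁ z₂ w : V} {κ : ℂ}
    (A1 : ∀ (a : ℂ) (t : ℝ), ‖a • z₁ + (t : ℂ) • w‖ ^ 2 = ‖a‖ ^ 2 + t ^ 2)
    (F1 : ∀ (a b b' : ℂ) (t t' : ℝ), ‖b + κ * a‖ ^ 2 + t ^ 2 = ‖b' + κ * a‖ ^ 2 + t' ^ 2 →
      ‖a • z₁ + b • z₂ + (t : ℂ) • w‖ = ‖a • z₁ + b' • z₂ + (t' : ℂ) • w‖)
    (F2 : ∀ (a a' b : ℂ) (t t' : ℝ),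
      ‖a + star κ * b‖ ^ 2 + t ^ 2 = ‖a' + star κ * b‖ ^ 2 + t' ^ 2 →
      ‖a • z₁ + b • z₂ + (t : ℂ) • w‖ = ‖a' • z₁ + b • z₂ + (t' : ℂ) • w‖)
    (hne : z₁ - κ • z₂ ≠ 0) : ‖κ‖ ≠ 1 := by
  intro hκ
  have hκκ : star κ * κ = 1 := by
    have := Complex.conj_mul' κ
    rw [hκ] at this
    simpa using this
  have hw : ‖w‖ = 1 :=
    (pow_eq_one_iff_of_nonneg (norm_nonneg w) two_ne_zero).1 (by simpa using A1 0 1)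
  have step : ∀ s : ℂ, ‖s • z₁ + (-κ * s) • z₂ + w‖ =
      ‖(s + 1) • z₁ + (-κ * (s + 1)) • z₂ + w‖ := by
    intro s
    have h1 := F2 s (s + 1) (-κ * s) 1 0 (by
      have e1 : s + star κ * (-κ * s) = 0 := by linear_combination (-s) * hκκ
      have e2 : s + 1 + star κ * (-κ * s) = 1 := by linear_combination (-s) * hκκ
      rw [e1, e2]; simp)
    have h2 := F1 (s + 1) (-κ * s) (-κ * (s + 1)) 0 1 (by
      have e1 : -κ * s + κ * (s + 1) = κ := by ring
      have e2 : -κ * (s + 1) + κ * (s + 1) = 0 := by ring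
      rw [e1, e2, hκ]; simp)
    simp only [Complex.ofReal_one, one_smul] at h1 h2
    rw [h1, h2]
  have all : ∀ k : ℕ, ‖(k : ℂ) • (z₁ - κ • z₂) + w‖ = 1 := by
    intro k
    induction k with
    | zero => simpa using hw
    | succ k ih =>
      rw [← ih]
      have := step k
      convert this.symm using 2
      · push_cast; module
      · module
  obtain ⟨k, hk⟩ := exists_nat_gt (2 / ‖z₁ - κ • z₂‖)
  have hpos : 0 < ‖z₁ - κ • z₂‖ := norm_pos_iff.mpr hne
  rw [div_lt_iff₀ hpos] at hk
  have h3 := norm_sub_le ((k : ℂ) • (z₁ - κ • z₂) + w) w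
  rw [add_sub_cancel_right, all, hw, norm_smul, Complex.norm_natCast] at h3
  linarith

theorem two_plane_norm_sq {z₁ z₂ w : V} {κ : ℂ}
    (A1 : ∀ (a : ℂ) (t : ℝ), ‖a • z₁ + (t : ℂ) • w‖ ^ 2 = ‖a‖ ^ 2 + t ^ 2)
    (F1 : ∀ (a b b' : ℂ) (t t' : ℝ), ‖b + κ * a‖ ^ 2 + t ^ 2 = ‖b' + κ * a‖ ^ 2 + t' ^ 2 →
      ‖a • z₁ + b • z₂ + (t : ℂ) • w‖ = ‖a • z₁ + b' • z₂ + (t' : ℂ) • w‖)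
    (F2 : ∀ (a a' b : ℂ) (t t' : ℝ),
      ‖a + star κ * b‖ ^ 2 + t ^ 2 = ‖a' + star κ * b‖ ^ 2 + t' ^ 2 →
      ‖a • z₁ + b • z₂ + (t : ℂ) • w‖ = ‖a' • z₁ + b • z₂ + (t' : ℂ) • w‖)
    (hlt : ‖κ‖ < 1) (s : ℂ) (t : ℝ) :
    ‖s • (z₁ - κ • z₂) + (t : ℂ) • w‖ ^ 2 = (1 - ‖κ‖ ^ 2) * ‖s‖ ^ 2 + t ^ 2 := by
  have hw : ‖w‖ = 1 :=
    (pow_eq_one_iff_of_nonneg (norm_nonneg w) two_ne_zero).1 (by simpa using A1 0 1)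
  have hκκ : star κ * κ = ((‖κ‖ ^ 2 : ℝ) : ℂ) := by
    have := Complex.conj_mul' κ
    simpa using this
  have hk0 := norm_nonneg κ
  have hk1 : ‖κ‖ ^ 2 < 1 := by nlinarith
  set k : ℝ := ‖κ‖ ^ 2 with hk
  have hknn : 0 ≤ k := sq_nonneg _
  have step : ∀ (s : ℂ) (t t' : ℝ), (1 - k) * ‖(k : ℂ) * s‖ ^ 2 + t' ^ 2
        = (1 - k) * ‖s‖ ^ 2 + t ^ 2 →
      ‖s • (z₁ - κ • z₂) + (t : ℂ) • w‖ =
      ‖((k : ℂ) * s) • (z₁ - κ • z₂) + (t' : ℂ) • w‖ := by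
    intro s t t' ht
    rw [norm_mul, Complex.norm_real, Real.norm_of_nonneg hknn] at ht
    set r : ℝ := √((1 - k) ^ 2 * ‖s‖ ^ 2 + t ^ 2) with hr
    have hr2 : r ^ 2 = (1 - k) ^ 2 * ‖s‖ ^ 2 + t ^ 2 := Real.sq_sqrt (by positivity)
    have h1 := F2 s (k * s) (-κ * s) t r (by
      have e1 : s + star κ * (-κ * s) = ((1 - k : ℝ) : ℂ) * s := by
        push_cast; linear_combination (-s) * hκκ
      have e2 : k * s + star κ * (-κ * s) = 0 := by linear_combination (-s) * hκκ
      rw [e1, e2, hr2, norm_mul, Complex.norm_real, Real.norm_of_nonneg (by linarith)]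
      simp only [norm_zero]
      ring)
    have h2 := F1 (k * s) (-κ * s) (-κ * (k * s)) r t' (by
      have e1 : -κ * s + κ * (k * s) = -κ * (((1 - k : ℝ) : ℂ) * s) := by push_cast; ring
      have e2 : -κ * (k * s) + κ * (k * s) = 0 := by ring
      rw [e1, e2, hr2, norm_mul, norm_mul, Complex.norm_real, Real.norm_of_nonneg (by linarith),
        norm_neg, norm_zero, mul_pow, ← hk]
      linear_combination -ht)
    have h3 : s • (z₁ - κ • z₂) + (t : ℂ) • w = s • z₁ + (-κ * s) • z₂ + (t : ℂ) • w := by module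
    have h4 : ((k : ℂ) * s) • (z₁ - κ • z₂) + (t' : ℂ) • w =
      ((k : ℂ) * s) • z₁ + (-κ * (k * s)) • z₂ + (t' : ℂ) • w := by module
    rw [h3, h4, h1, h2]
  set T : ℝ := (1 - k) * ‖s‖ ^ 2 + t ^ 2 with hT
  have hTnn : 0 ≤ T := by
    have : 0 ≤ 1 - k := by linarith
    positivity
  have hbound : ∀ m : ℕ, (1 - k) * ‖(k : ℂ) ^ m * s‖ ^ 2 ≤ T := by
    intro m
    rw [norm_mul, norm_pow, Complex.norm_real, Real.norm_of_nonneg hknn]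
    have h1 : k ^ m ≤ 1 := pow_le_one₀ hknn hk1.le
    have h2 : (k ^ m * ‖s‖) ^ 2 ≤ ‖s‖ ^ 2 := by
      apply pow_le_pow_left₀ (by positivity)
      exact mul_le_of_le_one_left (norm_nonneg _) h1
    nlinarith [sq_nonneg t]
  have all : ∀ m : ℕ, ‖((k : ℂ) ^ m * s) • (z₁ - κ • z₂) +
      ((√(T - (1 - k) * ‖(k : ℂ) ^ m * s‖ ^ 2) : ℝ) : ℂ) • w‖ =
      ‖s • (z₁ - κ • z₂) + (√(T - (1 - k) * ‖s‖ ^ 2) : ℂ) • w‖ := by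
    intro m
    induction m with
    | zero => simp
    | succ m ih =>
      rw [← ih]
      have e : (k : ℂ) ^ (m + 1) * s = k * (k ^ m * s) := by ring
      have hb := hbound (m + 1)
      rw [e] at hb ⊢
      refine (step _ _ _ ?_).symm
      rw [Real.sq_sqrt (by linarith), Real.sq_sqrt (by linarith [hbound m])]
      ring
  have lim0 : Filter.Tendsto (fun m : ℕ => (k : ℂ) ^ m * s) Filter.atTop (nhds 0) := by
    have := (tendsto_pow_atTop_nhds_zero_of_norm_lt_one (x := (k : ℂ)) (by
      rwa [Complex.norm_real, Real.norm_of_nonneg hknn])).mul_const s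
    simpa using this
  have cont : Continuous (fun x : ℂ => ‖x • (z₁ - κ • z₂) +
      ((√(T - (1 - k) * ‖x‖ ^ 2) : ℝ) : ℂ) • w‖) := by fun_prop
  have lim1 := (cont.tendsto 0).comp lim0
  have lim2 := lim1.congr (f₂ := fun _ => ‖s • (z₁ - κ • z₂) + (√(T - (1 - k) * ‖s‖ ^ 2) : ℂ) • w‖)
    (fun m => all m)
  have h5 := tendsto_nhds_unique lim2 tendsto_const_nhds
  have h6 : ‖s • (z₁ - κ • z₂) + (√(T - (1 - k) * ‖s‖ ^ 2) : ℂ) • w‖ ^ 2 = T := by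
    rw [← h5]
    simp [norm_smul, hw, abs_of_nonneg, Real.sq_sqrt hTnn]
  have h7 := F1 s (-κ * s) (-κ * s) t (√(T - (1 - k) * ‖s‖ ^ 2)) (by
    rw [Real.sq_sqrt (by rw [hT]; nlinarith [sq_nonneg t]), hT]; ring)
  have h8 : ∀ t : ℝ, s • (z₁ - κ • z₂) + (t : ℂ) • w =
      s • z₁ + (-κ * s) • z₂ + (t : ℂ) • w := by intro t; module
  rw [← h6, h8, h8, h7]

end TwoPlane

section Revolution

variable {V : Type*} [NormedAddCommGroup V] [NormedSpace ℂ V]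

/-- The norm satisfies the parallelogram law on the subspace `S`. -/
def IsEuclideanOn (S : Submodule ℂ V) : Prop :=
  ∀ x ∈ S, ∀ y ∈ S, ‖x + y‖ ^ 2 + ‖x - y‖ ^ 2 = 2 * (‖x‖ ^ 2 + ‖y‖ ^ 2)

/-- The norm on `G` is rotationally symmetric around an axis complementary to
`G ⊓ ker f`. -/
def IsRevolutionOn (G : Submodule ℂ V) (f : V →ₗ[ℂ] ℂ) : Prop :=
  IsEuclideanOn (G ⊓ LinearMap.ker f) ∧ ∃ u ∈ G, f u = 1 ∧
    ∀ y ∈ G, ∀ y' ∈ G, f y = 0 → f y' = 0 → ‖y‖ = ‖y'‖ → ‖u + y‖ = ‖u + y'‖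

/-- Pythagoras' theorem holds for `m` and every element of `R`. -/
def IsNormOrthogonal (m : V) (R : Submodule ℂ V) : Prop :=
  ∀ w ∈ R, ‖m + w‖ ^ 2 = ‖m‖ ^ 2 + ‖w‖ ^ 2

theorem IsEuclideanOn.mono {S T : Submodule ℂ V} (h : IsEuclideanOn T) (hST : S ≤ T) :
    IsEuclideanOn S :=
  fun x hx y hy => h x (hST hx) y (hST hy)

theorem IsNormOrthogonal.norm_smul_add {m : V} {R : Submodule ℂ V} (h : IsNormOrthogonal m R)
    (a : ℂ) {w : V} (hw : w ∈ R) : ‖a • m + w‖ ^ 2 = ‖a‖ ^ 2 * ‖m‖ ^ 2 + ‖w‖ ^ 2 := by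
  rcases eq_or_ne a 0 with rfl | ha
  · simp
  · have h1 : a • m + w = a • (m + a⁻¹ • w) := by rw [smul_add, smul_inv_smul₀ ha]
    have ha' : ‖a‖ ≠ 0 := norm_ne_zero_iff.mpr ha
    rw [h1, norm_smul, mul_pow, h _ (R.smul_mem _ hw), norm_smul, norm_inv]
    field_simp

theorem IsNormOrthogonal.smul {m : V} {R : Submodule ℂ V} (h : IsNormOrthogonal m R) (a : ℂ) :
    IsNormOrthogonal (a • m) R := fun w hw => by
  rw [h.norm_smul_add a hw, norm_smul, mul_pow]

/-- Orthogonal projection in a subspace on which the norm is Euclidean. -/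
theorem IsEuclideanOn.exists_isNormOrthogonal_sub [FiniteDimensional ℂ V] {N R : Submodule ℂ V}
    (hN : IsEuclideanOn N) (hR : R ≤ N) {y : V} (hy : y ∈ N) :
    ∃ r ∈ R, IsNormOrthogonal (y - r) R := by
  let _ : InnerProductSpace ℂ N := InnerProductSpace.ofNorm ℂ (fun x y => by
    have := hN x x.2 y y.2
    simp only [sq] at this
    exact this)
  let R' : Submodule ℂ N := R.comap N.subtype
  obtain ⟨r, hr, m, hm, hsum⟩ := R'.exists_add_mem_mem_orthogonal ⟨y, hy⟩
  refine ⟨r, hr, fun w hw => ?_⟩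
  have h1 : inner ℂ m (⟨w, hR hw⟩ : N) = 0 :=
    Submodule.inner_left_of_mem_orthogonal (K := R') hw hm
  have h2 := norm_add_sq_eq_norm_sq_add_norm_sq_of_inner_eq_zero m (⟨w, hR hw⟩ : N) h1
  have h3 : y - r = (m : V) := by
    have := congrArg (Subtype.val) hsum
    simp only [Submodule.coe_add] at this
    rw [this, add_sub_cancel_left]
  rw [h3]
  simp only [sq]
  exact h2

theorem norm_smul_add_eq_of_rotation {G : Submodule ℂ V} {f : V →ₗ[ℂ] ℂ} {u : V}
    (hu : ∀ y ∈ G, ∀ y' ∈ G, f y = 0 → f y' = 0 → ‖y‖ = ‖y'‖ → ‖u + y‖ = ‖u + y'‖)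
    (a : ℂ) {y y' : V} (hy : y ∈ G) (hy' : y' ∈ G) (h0 : f y = 0) (h0' : f y' = 0)
    (h : ‖y‖ = ‖y'‖) : ‖a • u + y‖ = ‖a • u + y'‖ := by
  rcases eq_or_ne a 0 with rfl | ha
  · simpa using h
  · have h1 : ∀ z, a • u + z = a • (u + a⁻¹ • z) := fun z => by
      rw [smul_add, smul_inv_smul₀ ha]
    rw [h1, h1, norm_smul, norm_smul, hu (a⁻¹ • y) (G.smul_mem _ hy) (a⁻¹ • y')
      (G.smul_mem _ hy') (by simp [h0]) (by simp [h0']) (by rw [norm_smul, norm_smul, h])]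

theorem isEuclideanOn_of_norm_sq_eq {G : Submodule ℂ V} {f : V →ₗ[ℂ] ℂ} {v : V} {c : ℝ}
    (hN : IsEuclideanOn (G ⊓ LinearMap.ker f)) (hv : v ∈ G) (hfv : f v ≠ 0)
    (h : ∀ (s : ℂ), ∀ y ∈ G, f y = 0 → ‖s • v + y‖ ^ 2 = c * ‖s‖ ^ 2 + ‖y‖ ^ 2) :
    IsEuclideanOn G := by
  have dec : ∀ x ∈ G, ∃ (s : ℂ), ∃ y ∈ G, f y = 0 ∧ x = s • v + y := fun x hx =>
    ⟨f x / f v, x - (f x / f v) • v, G.sub_mem hx (G.smul_mem _ hv), by simp [hfv], by simp⟩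
  intro x hx y hy
  obtain ⟨s, x, hxG, hx0, rfl⟩ := dec x hx
  obtain ⟨t, y, hyG, hy0, rfl⟩ := dec y hy
  have e1 : s • v + x + (t • v + y) = (s + t) • v + (x + y) := by module
  have e2 : s • v + x - (t • v + y) = (s - t) • v + (x - y) := by module
  rw [e1, e2, h _ _ (G.add_mem hxG hyG) (by simp [hx0, hy0]),
    h _ _ (G.sub_mem hxG hyG) (by simp [hx0, hy0]), h _ _ hxG hx0, h _ _ hyG hy0]
  have h1 := hN x ⟨hxG, hx0⟩ y ⟨hyG, hy0⟩
  have h2 := parallelogram_law_with_norm ℂ s t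
  linear_combination h1 + c * h2

theorem IsRevolutionOn.restrict [FiniteDimensional ℂ V] {H G : Submodule ℂ V} {f : V →ₗ[ℂ] ℂ}
    (h : IsRevolutionOn H f) (hGH : G ≤ H) {g : V} (hg : g ∈ G) (hfg : f g ≠ 0) :
    IsRevolutionOn G f := by
  obtain ⟨hN, u, huH, hfu, hu⟩ := h
  have hle : G ⊓ LinearMap.ker f ≤ H ⊓ LinearMap.ker f := inf_le_inf_right _ hGH
  set g' : V := (f g)⁻¹ • g with hg'
  have hg'G : g' ∈ G := G.smul_mem _ hg
  have hfg' : f g' = 1 := by simp [hg', hfg]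
  obtain ⟨r, hr, hm⟩ := hN.exists_isNormOrthogonal_sub hle (y := g' - u)
    ⟨H.sub_mem (hGH hg'G) huH, by simp [hfg', hfu]⟩
  have hr0 : f r = 0 := hr.2
  refine ⟨hN.mono hle, g' - r, G.sub_mem hg'G hr.1, by simp [hr0, hfg'], ?_⟩
  intro y hy y' hy' h0 h0' hyy
  have e : ∀ z, g' - r + z = u + ((g' - u - r) + z) := fun z => by abel
  have hmem : ∀ z ∈ G, g' - u - r + z ∈ H := fun z hz =>
    H.add_mem (H.sub_mem (H.sub_mem (hGH hg'G) huH) (hGH hr.1)) (hGH hz)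
  rw [e, e]
  refine hu _ (hmem y hy) _ (hmem y' hy') (by simp [hfg', hfu, hr0, h0])
    (by simp [hfg', hfu, hr0, h0']) ?_
  rw [← sq_eq_sq₀ (norm_nonneg _) (norm_nonneg _), hm y ⟨hy, h0⟩, hm y' ⟨hy', h0'⟩, hyy]

/-- If a section through the axis is Euclidean, then so is the whole body of revolution. -/
theorem isEuclideanOn_of_section_through_axis {H S : Submodule ℂ V} {f : V →ₗ[ℂ] ℂ} {u y : V}
    (hN : IsEuclideanOn (H ⊓ LinearMap.ker f)) (huH : u ∈ H) (hfu : f u = 1)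
    (hu : ∀ y ∈ H, ∀ y' ∈ H, f y = 0 → f y' = 0 → ‖y‖ = ‖y'‖ → ‖u + y‖ = ‖u + y'‖)
    (hSH : S ≤ H) (hS : IsEuclideanOn S) (huS : u ∈ S) (hyS : y ∈ S) (hfy : f y = 0)
    (hy0 : y ≠ 0) : IsEuclideanOn H := by
  have key : ∀ z ∈ H, f z = 0 → ‖u + z‖ ^ 2 = ‖u‖ ^ 2 + ‖z‖ ^ 2 := by
    intro z hz hfz
    set y' : V := ((‖z‖ / ‖y‖ : ℝ) : ℂ) • y with hy'
    have hyn : ‖y‖ ≠ 0 := norm_ne_zero_iff.mpr hy0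
    have hy'n : ‖y'‖ = ‖z‖ := by
      rw [hy', norm_smul, Complex.norm_real, Real.norm_of_nonneg (by positivity)]
      field_simp
    have hy'S : y' ∈ S := S.smul_mem _ hyS
    have hfy' : f y' = 0 := by simp [hy', hfy]
    have h1 := hu z hz y' (hSH hy'S) hfz hfy' hy'n.symm
    have h2 := hu y' (hSH hy'S) (-y') (H.neg_mem (hSH hy'S)) hfy' (by simp [hfy']) (by simp)
    have h3 := hS u huS y' hy'S
    rw [sub_eq_add_neg, ← h2, ← h1, hy'n] at h3
    linarith
  refine isEuclideanOn_of_norm_sq_eq (c := ‖u‖ ^ 2) hN huH (by simp [hfu]) ?_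
  intro s z hz hfz
  have ho : IsNormOrthogonal u (H ⊓ LinearMap.ker f) := fun w hw => key w hw.1 hw.2
  rw [ho.norm_smul_add s ⟨hz, hfz⟩]
  ring

theorem isNormOrthogonal_of_rotation {G N' R : Submodule ℂ V} {f : V →ₗ[ℂ] ℂ} {u m : V}
    (hu : ∀ y ∈ G, ∀ y' ∈ G, f y = 0 → f y' = 0 → ‖y‖ = ‖y'‖ → ‖u + y‖ = ‖u + y'‖)
    (hm : m ∈ G) (hfm : f m = 0) (hmR : IsNormOrthogonal m R) (hRG : R ≤ G)
    (hRf : ∀ r ∈ R, f r = 0) (hN' : IsEuclideanOn N') (hRN' : R ≤ N') (a : ℂ)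
    (hz : a • u + m ∈ N') : IsNormOrthogonal (a • u + m) R := by
  intro w hw
  have h1 := norm_smul_add_eq_of_rotation hu a (G.add_mem hm (hRG hw))
    (G.sub_mem hm (hRG hw)) (by simp [hfm, hRf w hw]) (by simp [hfm, hRf w hw]) (by
      rw [← sq_eq_sq₀ (norm_nonneg _) (norm_nonneg _), hmR w hw, sub_eq_add_neg,
        hmR (-w) (R.neg_mem hw), norm_neg])
  have h2 := hN' _ hz w (hRN' hw)
  rw [add_sub_assoc, ← h1, ← add_assoc] at h2
  linarith

/-- Two revolution structures with different hyperplanes of symmetry force the norm to be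
Euclidean. -/
theorem isEuclideanOn_of_isRevolutionOn_of_ne [FiniteDimensional ℂ V] {G : Submodule ℂ V}
    {f₁ f₂ : V →ₗ[ℂ] ℂ} (h₁ : IsRevolutionOn G f₁) (h₂ : IsRevolutionOn G f₂)
    (hG : 3 ≤ Module.finrank ℂ G) {x : V} (hx : x ∈ G) (hx₁ : f₁ x = 0) (hx₂ : f₂ x ≠ 0) :
    IsEuclideanOn G := by
  obtain ⟨hN₁, u₁, hu₁G, hfu₁, hu₁⟩ := h₁
  obtain ⟨hN₂, u₂, hu₂G, hfu₂, hu₂⟩ := h₂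
  set R : Submodule ℂ V := G ⊓ LinearMap.ker f₁ ⊓ LinearMap.ker f₂ with hR
  have hRG : R ≤ G := inf_le_left.trans inf_le_left
  have hR₁ : ∀ r ∈ R, f₁ r = 0 := fun r hr => hr.1.2
  have hR₂ : ∀ r ∈ R, f₂ r = 0 := fun r hr => hr.2
  have hRN₁ : R ≤ G ⊓ LinearMap.ker f₁ := inf_le_left
  have hRN₂ : R ≤ G ⊓ LinearMap.ker f₂ := fun r hr => ⟨hRG hr, hR₂ r hr⟩
  obtain ⟨w, hwR, hw⟩ : ∃ w ∈ R, ‖w‖ = 1 := by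
    have hker := LinearMap.ker_ne_bot_of_finrank_lt (f := (f₁.prod f₂).domRestrict G) (by
      simp only [Module.finrank_prod, Module.finrank_self]; omega)
    obtain ⟨v, hv, hv0⟩ := (Submodule.ne_bot_iff _).1 hker
    have hv' : f₁ v = 0 ∧ f₂ v = 0 := by simpa using hv
    have hv0' : ‖(v : V)‖ ≠ 0 := by simpa using hv0
    refine ⟨((‖(v : V)‖⁻¹ : ℝ) : ℂ) • (v : V), R.smul_mem _ ⟨⟨v.2, hv'.1⟩, hv'.2⟩, ?_⟩
    rw [norm_smul, Complex.norm_real, norm_inv, norm_norm, inv_mul_cancel₀ hv0']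
  obtain ⟨z₂, hz₂G, hz₂₁, hz₂₂, hz₂R, hz₂⟩ : ∃ z₂ ∈ G, f₁ z₂ = 0 ∧ f₂ z₂ ≠ 0 ∧
      IsNormOrthogonal z₂ R ∧ ‖z₂‖ = 1 := by
    obtain ⟨r, hr, ho⟩ := hN₁.exists_isNormOrthogonal_sub hRN₁ ⟨hx, hx₁⟩
    have hf2 : f₂ (x - r) ≠ 0 := by simpa [hR₂ r hr] using hx₂
    have hne : x - r ≠ 0 := fun h => hf2 (by rw [h, map_zero])
    have hne' : ‖x - r‖ ≠ 0 := norm_ne_zero_iff.mpr hne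
    refine ⟨((‖x - r‖⁻¹ : ℝ) : ℂ) • (x - r), G.smul_mem _ (G.sub_mem hx (hRG hr)),
      by simp [hx₁, hR₁ r hr], ?_, ho.smul _, ?_⟩
    · rw [map_smul, smul_eq_mul]
      exact mul_ne_zero (by simpa using hne) hf2
    · rw [norm_smul, Complex.norm_real, norm_inv, norm_norm, inv_mul_cancel₀ hne']
  obtain ⟨z₁, c₁, κ, hz₁G, hz₁₁, hz₁₂, hz₁R, hz₁, hc₁, hv₁⟩ : ∃ (z₁ : V) (c₁ κ : ℂ), z₁ ∈ G ∧
      f₁ z₁ ≠ 0 ∧ f₂ z₁ = 0 ∧ IsNormOrthogonal z₁ R ∧ ‖z₁‖ = 1 ∧ c₁ ≠ 0 ∧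
      z₁ - κ • z₂ = c₁ • u₁ := by
    set b : ℂ := -(f₂ u₁ / f₂ z₂) with hb
    set z : V := (1 : ℂ) • u₁ + b • z₂ with hz
    have hzG : z ∈ G := G.add_mem (G.smul_mem _ hu₁G) (G.smul_mem _ hz₂G)
    have hz2 : f₂ z = 0 := by simp [hz, hb, hz₂₂]
    have hz1 : f₁ z = 1 := by simp [hz, hz₂₁, hfu₁]
    have ho : IsNormOrthogonal z R := isNormOrthogonal_of_rotation hu₁ (G.smul_mem b hz₂G)
      (by simp [hz₂₁]) (hz₂R.smul b) hRG hR₁ hN₂ hRN₂ 1 ⟨hzG, hz2⟩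
    have hne : z ≠ 0 := fun h => by simp [h] at hz1
    have hne' : ‖z‖ ≠ 0 := norm_ne_zero_iff.mpr hne
    have hc : ((‖z‖⁻¹ : ℝ) : ℂ) ≠ 0 := by simpa using hne
    refine ⟨((‖z‖⁻¹ : ℝ) : ℂ) • z, ((‖z‖⁻¹ : ℝ) : ℂ), ((‖z‖⁻¹ : ℝ) : ℂ) * b,
      G.smul_mem _ hzG, ?_, ?_, ho.smul _, ?_, hc, ?_⟩
    · rw [map_smul, hz1, smul_eq_mul, mul_one]; exact hc
    · rw [map_smul, hz2, smul_zero]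
    · rw [norm_smul, Complex.norm_real, norm_inv, norm_norm, inv_mul_cancel₀ hne']
    · rw [hz]; module
  obtain ⟨κ', hv₂⟩ : ∃ κ' : ℂ, z₂ - κ' • z₁ = f₂ z₂ • u₂ := by
    set y : V := z₂ - f₂ z₂ • u₂ with hy
    set κ' : ℂ := f₁ y / f₁ z₁ with hκ'
    set r : V := y - κ' • z₁ with hr
    have hyG : y ∈ G := G.sub_mem hz₂G (G.smul_mem _ hu₂G)
    have hrR : r ∈ R := by
      refine ⟨⟨G.sub_mem hyG (G.smul_mem _ hz₁G), ?_⟩, ?_⟩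
      · simp [hr, hκ', hz₁₁]
      · simp [hr, hy, hfu₂, hz₁₂]
    have hz' : f₂ z₂ • u₂ + κ' • z₁ = z₂ - r := by rw [hr, hy]; abel
    have ho : IsNormOrthogonal (f₂ z₂ • u₂ + κ' • z₁) R :=
      isNormOrthogonal_of_rotation hu₂ (G.smul_mem κ' hz₁G) (by simp [hz₁₂]) (hz₁R.smul κ')
        hRG hR₂ hN₁ hRN₁ _ (by
          rw [hz']; exact ⟨G.sub_mem hz₂G (hRG hrR), by simp [hz₂₁, hR₁ r hrR]⟩)
    have h1 := ho r hrR
    have h2 := hz₂R (-r) (R.neg_mem hrR)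
    rw [hz', sub_add_cancel] at h1
    rw [← sub_eq_add_neg, norm_neg] at h2
    have h3 : ‖r‖ = 0 := by
      have : ‖r‖ ^ 2 = 0 := by linarith
      exact pow_eq_zero_iff two_ne_zero |>.1 this
    refine ⟨κ', ?_⟩
    rw [norm_eq_zero.1 h3, sub_zero] at hz'
    rw [← hz', add_sub_cancel_right]
    simp only [map_add, map_smul, hfu₂, hz₁₂, smul_eq_mul, mul_one, mul_zero, add_zero]
  have htw : ∀ t : ℝ, (t : ℂ) • w ∈ R := fun t => R.smul_mem _ hwR
  have hntw : ∀ t : ℝ, ‖(t : ℂ) • w‖ ^ 2 = t ^ 2 := fun t => by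
    rw [norm_smul, hw, mul_one, Complex.norm_real, Real.norm_eq_abs, sq_abs]
  have A1 : ∀ (a : ℂ) (t : ℝ), ‖a • z₁ + (t : ℂ) • w‖ ^ 2 = ‖a‖ ^ 2 + t ^ 2 := fun a t => by
    rw [hz₁R.norm_smul_add a (htw t), hz₁, hntw]; ring
  have A2 : ∀ (b : ℂ) (t : ℝ), ‖b • z₂ + (t : ℂ) • w‖ ^ 2 = ‖b‖ ^ 2 + t ^ 2 := fun b t => by
    rw [hz₂R.norm_smul_add b (htw t), hz₂, hntw]; ring
  have F1 : ∀ (a b b' : ℂ) (t t' : ℝ),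
      ‖b + κ * a‖ ^ 2 + t ^ 2 = ‖b' + κ * a‖ ^ 2 + t' ^ 2 →
      ‖a • z₁ + b • z₂ + (t : ℂ) • w‖ = ‖a • z₁ + b' • z₂ + (t' : ℂ) • w‖ := by
    intro a b b' t t' h
    have e : ∀ (b : ℂ) (t : ℝ), a • z₁ + b • z₂ + (t : ℂ) • w =
        (a * c₁) • u₁ + ((b + κ * a) • z₂ + (t : ℂ) • w) := fun b t => by
      rw [mul_smul, ← hv₁]; module
    rw [e, e]
    refine norm_smul_add_eq_of_rotation hu₁ _
      (G.add_mem (G.smul_mem _ hz₂G) (hRG (htw t)))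
      (G.add_mem (G.smul_mem _ hz₂G) (hRG (htw t')))
      (by rw [map_add, map_smul, hz₂₁, hR₁ _ (htw t)]; simp)
      (by rw [map_add, map_smul, hz₂₁, hR₁ _ (htw t')]; simp) ?_
    rw [← sq_eq_sq₀ (norm_nonneg _) (norm_nonneg _), A2, A2, h]
  have F2 : ∀ (a a' b : ℂ) (t t' : ℝ),
      ‖a + κ' * b‖ ^ 2 + t ^ 2 = ‖a' + κ' * b‖ ^ 2 + t' ^ 2 →
      ‖a • z₁ + b • z₂ + (t : ℂ) • w‖ = ‖a' • z₁ + b • z₂ + (t' : ℂ) • w‖ := by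
    intro a a' b t t' h
    have e : ∀ (a : ℂ) (t : ℝ), a • z₁ + b • z₂ + (t : ℂ) • w =
        (b * f₂ z₂) • u₂ + ((a + κ' * b) • z₁ + (t : ℂ) • w) := fun a t => by
      rw [mul_smul, ← hv₂]; module
    rw [e, e]
    refine norm_smul_add_eq_of_rotation hu₂ _
      (G.add_mem (G.smul_mem _ hz₁G) (hRG (htw t)))
      (G.add_mem (G.smul_mem _ hz₁G) (hRG (htw t')))
      (by rw [map_add, map_smul, hz₁₂, hR₂ _ (htw t)]; simp)
      (by rw [map_add, map_smul, hz₁₂, hR₂ _ (htw t')]; simp) ?_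
    rw [← sq_eq_sq₀ (norm_nonneg _) (norm_nonneg _), A1, A1, h]
  obtain rfl := two_plane_cross_coeff A1 A2 F1 F2
  have hfv : f₁ (z₁ - κ • z₂) ≠ 0 := by simpa [hz₂₁] using hz₁₁
  have hvne : z₁ - κ • z₂ ≠ 0 := fun h => hfv (by rw [h, map_zero])
  have hlt : ‖κ‖ < 1 :=
    lt_of_le_of_ne (two_plane_norm_le_one A1 F1) (two_plane_norm_ne_one A1 F1 F2 hvne)
  refine isEuclideanOn_of_norm_sq_eq (c := 1 - ‖κ‖ ^ 2) hN₁
    (G.sub_mem hz₁G (G.smul_mem κ hz₂G)) hfv ?_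
  intro s y hy hfy
  rw [← two_plane_norm_sq A1 F1 F2 hlt s ‖y‖, hv₁, smul_smul]
  rw [norm_smul_add_eq_of_rotation hu₁ _ hy (hRG (htw ‖y‖)) hfy (hR₁ _ (htw _)) (by
    rw [norm_smul, hw, Complex.norm_real, norm_norm, mul_one])]

theorem exists_finrank_eq_of_finrank_le [FiniteDimensional ℂ V] {n : ℕ}
    (hV : Module.finrank ℂ V = n + 1) {S : Submodule ℂ V} (hS : Module.finrank ℂ S ≤ n) :
    ∃ H : Submodule ℂ V, Module.finrank ℂ H = n ∧ S ≤ H := by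
  have hlt : S < ⊤ := lt_top_iff_ne_top.2 (fun h => by
    rw [h, finrank_top] at hS; omega)
  obtain ⟨f, hf, hSf⟩ := Submodule.exists_le_ker_of_lt_top S hlt
  refine ⟨LinearMap.ker f, ?_, hSf⟩
  have := Module.Dual.finrank_ker_add_one_of_ne_zero hf
  omega

theorem finrank_le_three_span (x y z : V) :
    Module.finrank ℂ (Submodule.span ℂ ({x, y, z} : Set V)) ≤ 3 := by
  classical
  have h := finrank_span_finset_le_card (R := ℂ) ({x, y, z} : Finset V)
  have h2 := Finset.card_le_three (a := x) (b := y) (c := z)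
  rw [Set.finrank, show (({x, y, z} : Finset V) : Set V) = {x, y, z} by simp] at h
  exact h.trans h2

/-- If the norm is rotationally symmetric on every hyperplane of a complex normed space of
dimension at least five, then it is Euclidean on some hyperplane. -/
theorem exists_isEuclideanOn_of_forall_isRevolutionOn [FiniteDimensional ℂ V] {n : ℕ}
    (hn : 4 ≤ n) (hV : Module.finrank ℂ V = n + 1)
    (hrev : ∀ H : Submodule ℂ V, Module.finrank ℂ H = n → ∃ f, IsRevolutionOn H f) :
    ∃ W : Submodule ℂ V, Module.finrank ℂ W = n ∧ IsEuclideanOn W := by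
  obtain ⟨H₁, hH₁, -⟩ := exists_finrank_eq_of_finrank_le hV (S := ⊥) (by simp)
  obtain ⟨f₁, hf₁⟩ := hrev H₁ hH₁
  by_cases hE : IsEuclideanOn H₁
  · exact ⟨H₁, hH₁, hE⟩
  obtain ⟨hN₁, u, huH₁, hfu, hu⟩ := id hf₁
  have dim_inf : ∀ H H' : Submodule ℂ V, Module.finrank ℂ H' = n →
      Module.finrank ℂ H ≤ Module.finrank ℂ (H ⊓ H' : Submodule ℂ V) + 1 := by
    intro H H' hH'
    have h1 := Submodule.finrank_sup_add_finrank_inf_eq H H'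
    have h2 := Submodule.finrank_le (H ⊔ H')
    omega
  have key : ∀ H H' : Submodule ℂ V, Module.finrank ℂ H = n → Module.finrank ℂ H' = n →
      u ∈ H → u ∈ H' → ∀ f f', IsRevolutionOn H f → IsRevolutionOn H' f' →
      ∀ x ∈ H, x ∈ H' → f x = 0 → f' x = 0 := by
    intro H H' hH hH' huH huH' f f' hf hf' x hx hx' hfx
    have hd1 := dim_inf H H' hH'
    have hd2 := dim_inf (H ⊓ H') H₁ hH₁
    have hnE : ¬ IsEuclideanOn (H ⊓ H') := by
      intro hEG
      have hker := LinearMap.ker_ne_bot_of_finrank_lt (f := f₁.domRestrict (H ⊓ H' ⊓ H₁)) (by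
        simp only [Module.finrank_self]; omega)
      obtain ⟨v, hv, hv0⟩ := (Submodule.ne_bot_iff _).1 hker
      exact hE (isEuclideanOn_of_section_through_axis hN₁ huH₁ hfu hu inf_le_right
        (hEG.mono inf_le_left) ⟨⟨huH, huH'⟩, huH₁⟩ v.2 (by simpa using hv) (by simpa using hv0))
    have hex : ∀ K g, IsRevolutionOn K g → H ⊓ H' ≤ K → IsRevolutionOn (H ⊓ H') g := by
      intro K g hg hle
      by_contra hcon
      refine hnE (hg.1.mono (le_inf hle fun y hy => ?_))
      by_contra hy0
      exact hcon (hg.restrict hle hy hy0)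
    by_contra hfx'
    exact hnE (isEuclideanOn_of_isRevolutionOn_of_ne (hex H f hf inf_le_left)
      (hex H' f' hf' inf_le_right) (by omega) ⟨hx, hx'⟩ hfx hfx')
  have hfu0 : ∀ H : Submodule ℂ V, Module.finrank ℂ H = n → u ∈ H → ∀ f, IsRevolutionOn H f →
      f u ≠ 0 := by
    intro H hH huH f hf h0
    have := key H H₁ hH hH₁ huH huH₁ f f₁ hf hf₁ u huH huH₁ h0
    simp [hfu] at this
  have hcover : ∀ x y : V, ∃ H : Submodule ℂ V, Module.finrank ℂ H = n ∧ u ∈ H ∧ x ∈ H ∧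
      y ∈ H := by
    intro x y
    obtain ⟨H, hH, hle⟩ := exists_finrank_eq_of_finrank_le hV
      (S := Submodule.span ℂ ({u, x, y} : Set V)) ((finrank_le_three_span u x y).trans (by omega))
    rw [Submodule.span_le] at hle
    exact ⟨H, hH, hle (by simp), hle (by simp), hle (by simp)⟩
  have hglue : ∀ x : V, ∃ c : ℂ, ∀ H : Submodule ℂ V, Module.finrank ℂ H = n → u ∈ H → x ∈ H →
      ∀ f, IsRevolutionOn H f → f x = c * f u := by
    intro x
    obtain ⟨K, hK, huK, hxK, -⟩ := hcover x x
    obtain ⟨g, hg⟩ := hrev K hK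
    have hgu := hfu0 K hK huK g hg
    refine ⟨g x / g u, fun H hH huH hxH f hf => ?_⟩
    have := key K H hK hH huK huH g f hg hf (x - (g x / g u) • u)
      (K.sub_mem hxK (K.smul_mem _ huK)) (H.sub_mem hxH (H.smul_mem _ huH)) (by simp [hgu])
    rw [map_sub, map_smul, smul_eq_mul] at this
    exact sub_eq_zero.1 this
  choose F hF using hglue
  let L : V →ₗ[ℂ] ℂ :=
    { toFun := F
      map_add' := fun x y => by
        obtain ⟨H, hH, huH, hx, hy⟩ := hcover x y
        obtain ⟨f, hf⟩ := hrev H hH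
        have h0 := hfu0 H hH huH f hf
        have h1 := hF (x + y) H hH huH (H.add_mem hx hy) f hf
        rw [map_add, hF x H hH huH hx f hf, hF y H hH huH hy f hf, ← add_mul] at h1
        exact (mul_right_cancel₀ h0 h1).symm
      map_smul' := fun a x => by
        obtain ⟨H, hH, huH, hx, -⟩ := hcover x x
        obtain ⟨f, hf⟩ := hrev H hH
        have h0 := hfu0 H hH huH f hf
        have h1 := hF (a • x) H hH huH (H.smul_mem a hx) f hf
        rw [map_smul, hF x H hH huH hx f hf, smul_eq_mul, ← mul_assoc] at h1
        exact (mul_right_cancel₀ h0 h1).symm }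
  have hLu : L u ≠ 0 := by
    intro h0
    have := hF u H₁ hH₁ huH₁ huH₁ f₁ hf₁
    change F u = 0 at h0
    rw [h0, zero_mul, hfu] at this
    exact one_ne_zero this
  have hL : L ≠ 0 := fun h => hLu (by rw [h, LinearMap.zero_apply])
  refine ⟨LinearMap.ker L, ?_, ?_⟩
  · have := Module.Dual.finrank_ker_add_one_of_ne_zero hL
    omega
  · intro x hx y hy
    obtain ⟨H, hH, huH, hxH, hyH⟩ := hcover x y
    obtain ⟨f, hf⟩ := hrev H hH
    have hx0 : F x = 0 := hx
    have hy0 : F y = 0 := hy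
    exact hf.1 x ⟨hxH, by simpa [hx0] using hF x H hH huH hxH f hf⟩
      y ⟨hyH, by simpa [hy0] using hF y H hH huH hyH f hf⟩

end Revolution

section Transfer

variable {V : Type*} [NormedAddCommGroup V] [NormedSpace ℂ V]

theorem IsComplexSymmetric.smul_mem {E : Type*} [NormedAddCommGroup E] [InnerProductSpace ℂ E]
    {K : Set E} (hK : IsComplexSymmetric K) {ξ : ℂ} (hξ : ‖ξ‖ = 1) {x : E} (hx : x ∈ K) :
    ξ • x ∈ K := by
  rw [← hK ξ hξ]
  exact ⟨x, hx, rfl⟩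

/-- A complex symmetric convex body is the unit ball of a norm. -/
theorem exists_norm_le_one_iff_mem.{w} {E : Type w} [NormedAddCommGroup E] [InnerProductSpace ℂ E]
    {B : Set E} (hc : IsCompact B) (hconv : Convex ℝ B) (hint : (interior B).Nonempty)
    (hsym : IsComplexSymmetric B) :
    ∃ (V : Type w) (_ : NormedAddCommGroup V) (_ : NormedSpace ℂ V) (e : E ≃ₗ[ℂ] V),
      ∀ x, x ∈ B ↔ ‖e x‖ ≤ 1 := by
  have h0 : (0 : E) ∈ interior B := by
    obtain ⟨x, hx⟩ := hint
    have hneg : -x ∈ B := by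
      have := hsym.smul_mem (ξ := -1) (by simp) (interior_subset hx)
      simpa using this
    refine hconv.openSegment_interior_self_subset_interior hx hneg ?_
    exact ⟨1 / 2, 1 / 2, by norm_num, by norm_num, by norm_num, by simp⟩
  have hn0 : B ∈ nhds (0 : E) := mem_interior_iff_mem_nhds.1 h0
  have habs : Absorbent ℝ B := absorbent_nhds_zero hn0
  have hbal : Balanced ℂ B := by
    rw [balanced_iff_smul_mem]
    intro a ha x hx
    rcases eq_or_ne a 0 with rfl | ha0
    · simpa using interior_subset h0
    · have hna : ‖a‖ ≠ 0 := norm_ne_zero_iff.mpr ha0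
      have h1 : (a / (‖a‖ : ℝ)) • x ∈ B := hsym.smul_mem (by
        rw [norm_div, Complex.norm_real, norm_norm, div_self hna]) hx
      have h2 := hconv.smul_mem_of_zero_mem (interior_subset h0) h1 ⟨norm_nonneg a, ha⟩
      have hna' : ((‖a‖ : ℝ) : ℂ) ≠ 0 := by exact_mod_cast hna
      rwa [← Complex.coe_smul, smul_smul, mul_div_cancel₀ _ hna'] at h2
  let p : Seminorm ℂ E := gaugeSeminorm hbal hconv habs
  have hp0 : ∀ x, p x = 0 → x = 0 := fun x hx =>
    (gauge_eq_zero habs ((NormedSpace.isVonNBounded_iff ℝ).2 hc.isBounded)).1 hx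
  have hmem : ∀ x, x ∈ B ↔ p x ≤ 1 := fun x => by
    change x ∈ B ↔ gauge B x ≤ 1
    rw [gauge_le_one_iff_mem_closure hconv hn0, hc.isClosed.closure_eq]
  let iM : Module ℂ E := inferInstance
  let iN : NormedAddCommGroup E :=
    AddGroupNorm.toNormedAddCommGroup
      { toFun := p, map_zero' := map_zero p, add_le' := map_add_le_add p,
        neg' := fun x => map_neg_eq_map p x, eq_zero_of_map_eq_zero' := hp0 }
  let iS : @NormedSpace ℂ E _ iN.toSeminormedAddCommGroup :=
    @NormedSpace.mk ℂ E _ iN.toSeminormedAddCommGroup iM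
      (fun a x => (map_smul_eq_mul p a x).le)
  refine ⟨E, iN, iS, @LinearEquiv.refl ℂ E _ _ iM, hmem⟩

section Sections

variable {F : Type*} [NormedAddCommGroup F] [InnerProductSpace ℂ F] {K : Set F} {u : F}
  {T : F →ₗ[ℂ] V}

theorem exists_norm_eq_mul_norm_of_sections (hT : Function.Injective T)
    (hK : ∀ x, x ∈ K ↔ ‖T x‖ ≤ 1) {y₀ : F} (hy₀ : y₀ ≠ 0) (hy₀u : inner ℂ u y₀ = 0)
    (hrev : K ∩ {x | inner ℂ u x = (0 : ℂ)} = ∅ ∨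
      (∃ x, K ∩ {x | inner ℂ u x = (0 : ℂ)} = {x}) ∨
      (∃ r : ℝ, 0 < r ∧ K ∩ {x | inner ℂ u x = (0 : ℂ)} =
        {x | inner ℂ u x = (0 : ℂ) ∧ dist x ((0 : ℂ) • u) ≤ r})) :
    ∃ r : ℝ, 0 < r ∧ ∀ y, inner ℂ u y = (0 : ℂ) → ‖y‖ = r * ‖T y‖ := by
  have hTpos : ∀ y, y ≠ 0 → 0 < ‖T y‖ := fun y hy =>
    norm_pos_iff.mpr (fun h => hy (hT (by rw [h, map_zero])))
  have hm0 : (0 : F) ∈ K ∩ {x | inner ℂ u x = (0 : ℂ)} := ⟨by simp [hK], by simp⟩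
  have hm1 : ((‖T y₀‖⁻¹ : ℝ) : ℂ) • y₀ ∈ K ∩ {x | inner ℂ u x = (0 : ℂ)} := by
    refine ⟨?_, by simp [hy₀u]⟩
    rw [hK, map_smul, norm_smul, Complex.norm_real, norm_inv, norm_norm,
      inv_mul_cancel₀ (hTpos y₀ hy₀).ne']
  rcases hrev with h | ⟨x, h⟩ | ⟨r, hr, h⟩
  · rw [h] at hm0; exact hm0.elim
  · rw [h] at hm0 hm1
    have h1 : (0 : F) = x := hm0
    have h2 : ((‖T y₀‖⁻¹ : ℝ) : ℂ) • y₀ = x := hm1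
    rw [← h1] at h2
    have := (smul_eq_zero.1 h2).resolve_right hy₀
    have h3 : ‖T y₀‖⁻¹ = 0 := by exact_mod_cast this
    exact absurd (inv_eq_zero.1 h3) (hTpos y₀ hy₀).ne'
  · refine ⟨r, hr, fun y hy => ?_⟩
    rcases eq_or_ne y 0 with rfl | hy0
    · simp
    have hT0 := hTpos y hy0
    have hn0 : 0 < ‖y‖ := norm_pos_iff.mpr hy0
    have hiff : ∀ x, inner ℂ u x = (0 : ℂ) → (‖T x‖ ≤ 1 ↔ ‖x‖ ≤ r) := by
      intro x hx
      have := Set.ext_iff.1 h x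
      simp only [Set.mem_inter_iff, Set.mem_ofPred_eq, hx, true_and, and_true, zero_smul,
        dist_zero_right, hK] at this
      exact this
    have h1 := (hiff (((‖T y‖⁻¹ : ℝ) : ℂ) • y) (by simp [hy])).1 (by
      rw [map_smul, norm_smul, Complex.norm_real, norm_inv, norm_norm,
        inv_mul_cancel₀ hT0.ne'])
    have h2 := (hiff (((r / ‖y‖ : ℝ) : ℂ) • y) (by simp [hy])).2 (by
      rw [norm_smul, Complex.norm_real, Real.norm_of_nonneg (by positivity),
        div_mul_cancel₀ _ hn0.ne'])
    rw [norm_smul, Complex.norm_real, norm_inv, norm_norm, inv_mul_le_iff₀ hT0] at h1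
    rw [map_smul, norm_smul, Complex.norm_real, Real.norm_of_nonneg (by positivity),
      div_mul_eq_mul_div, div_le_one hn0] at h2
    linarith

theorem norm_le_of_sections (hT : Function.Injective T) (hK : ∀ x, x ∈ K ↔ ‖T x‖ ≤ 1)
    (hu : ‖u‖ = 1) {y₀ : F} (hy₀ : y₀ ≠ 0) (hy₀u : inner ℂ u y₀ = 0)
    (hrev : ∀ z : ℂ, K ∩ {x | inner ℂ u x = z} = ∅ ∨
      (∃ x, K ∩ {x | inner ℂ u x = z} = {x}) ∨
      (∃ r : ℝ, 0 < r ∧ K ∩ {x | inner ℂ u x = z} =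
        {x | inner ℂ u x = z ∧ dist x (z • u) ≤ r}))
    {y y' : F} (hy : inner ℂ u y = 0) (hy' : inner ℂ u y' = 0) (hyy : ‖y‖ = ‖y'‖) :
    ‖T (u + y')‖ ≤ ‖T (u + y)‖ := by
  by_contra! hlt
  obtain ⟨t, ht1, ht2⟩ := exists_between hlt
  have ht : 0 < t := (norm_nonneg _).trans_lt ht1
  have hTy₀ : 0 < ‖T y₀‖ := norm_pos_iff.mpr (fun h => hy₀ (hT (by rw [h, map_zero])))
  have huu : inner ℂ u u = (1 : ℂ) := by rw [inner_self_eq_norm_sq_to_K, hu]; simp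
  set z : ℂ := ((t⁻¹ : ℝ) : ℂ) with hz
  have hzn : ‖z‖ = t⁻¹ := by
    rw [hz, Complex.norm_real, Real.norm_of_nonneg (by positivity)]
  have hin : ∀ v, inner ℂ u v = (0 : ℂ) → inner ℂ u (z • (u + v)) = z := fun v hv => by
    rw [inner_smul_right, inner_add_right, huu, hv]; simp
  have hnK : z • (u + y') ∉ K := by
    rw [hK, map_smul, norm_smul, hzn, not_le, inv_mul_eq_div, one_lt_div ht]
    exact ht2
  have hmem : z • (u + y) ∈ K ∩ {x | inner ℂ u x = z} := by
    refine ⟨?_, hin y hy⟩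
    rw [hK, map_smul, norm_smul, hzn, inv_mul_eq_div, div_le_one ht]
    exact ht1.le
  rcases hrev z with h | ⟨x, h⟩ | ⟨r, hr, h⟩
  · rw [h] at hmem; exact hmem.elim
  · set ε : ℝ := (t - ‖T (u + y)‖) / ‖T y₀‖ with hε
    have hεpos : 0 < ε := div_pos (by linarith) hTy₀
    have hmem' : z • (u + (y + (ε : ℂ) • y₀)) ∈ K ∩ {x | inner ℂ u x = z} := by
      refine ⟨?_, hin _ (by rw [inner_add_right, inner_smul_right, hy, hy₀u]; simp)⟩
      rw [hK, map_smul, norm_smul, hzn, inv_mul_eq_div, div_le_one ht, ← add_assoc, map_add,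
        map_smul]
      refine (norm_add_le _ _).trans ?_
      rw [norm_smul, Complex.norm_real, Real.norm_of_nonneg hεpos.le, hε,
        div_mul_cancel₀ _ hTy₀.ne']
      linarith
    rw [h] at hmem hmem'
    have h1 : z • (u + (y + (ε : ℂ) • y₀)) = z • (u + y) := Eq.trans hmem' hmem.symm
    have hz0 : z ≠ 0 := by
      rw [← norm_ne_zero_iff, hzn]; positivity
    have h2 := smul_right_injective F hz0 h1
    rw [← add_assoc, add_eq_left] at h2
    have h3 := (smul_eq_zero.1 h2).resolve_right hy₀
    exact hεpos.ne' (by exact_mod_cast h3)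
  · have hd : ∀ v, dist (z • (u + v)) (z • u) = ‖z‖ * ‖v‖ := fun v => by
      rw [dist_eq_norm, ← smul_sub, add_sub_cancel_left, norm_smul]
    rw [h] at hmem
    have h1 : z • (u + y') ∈ K ∩ {x | inner ℂ u x = z} := by
      rw [h]
      refine ⟨hin y' hy', ?_⟩
      rw [hd, ← hyy, ← hd]
      exact hmem.2
    exact hnK h1.1

theorem exists_isRevolutionOn_range [FiniteDimensional ℂ F] (hF : 2 ≤ Module.finrank ℂ F)
    (hT : Function.Injective T) (hK : ∀ x, x ∈ K ↔ ‖T x‖ ≤ 1)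
    (hrev : IsComplexBodyOfRevolution K) :
    ∃ f, IsRevolutionOn (LinearMap.range T) f := by
  obtain ⟨-, -, -, -, u, hu, hrev⟩ := hrev
  obtain ⟨y₀, hy₀u, hy₀⟩ : ∃ y₀ : F, inner ℂ u y₀ = 0 ∧ y₀ ≠ 0 := by
    have hker := LinearMap.ker_ne_bot_of_finrank_lt (f := innerₛₗ ℂ u) (by
      simp only [Module.finrank_self]; omega)
    obtain ⟨v, hv, hv0⟩ := (Submodule.ne_bot_iff _).1 hker
    exact ⟨v, by simpa using hv, hv0⟩
  obtain ⟨r, hr, hN⟩ := exists_norm_eq_mul_norm_of_sections hT hK hy₀ hy₀u (hrev 0)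
  obtain ⟨S, hS⟩ := T.exists_leftInverse_of_injective (LinearMap.ker_eq_bot.2 hT)
  have hST : ∀ x, S (T x) = x := fun x => LinearMap.congr_fun hS x
  have huu : inner ℂ u u = (1 : ℂ) := by rw [inner_self_eq_norm_sq_to_K, hu]; simp
  have hf : ∀ x, (innerₛₗ ℂ u ∘ₗ S) (T x) = inner ℂ u x := fun x => by simp [hST]
  refine ⟨innerₛₗ ℂ u ∘ₗ S, ?_, T u, ⟨u, rfl⟩, by rw [hf, huu], ?_⟩
  · rintro _ ⟨⟨x, rfl⟩, hx⟩ _ ⟨⟨y, rfl⟩, hy⟩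
    have hx' : inner ℂ u x = (0 : ℂ) := (hf x).symm.trans hx
    have hy' : inner ℂ u y = (0 : ℂ) := (hf y).symm.trans hy
    have h := parallelogram_law_with_norm ℂ x y
    rw [hN x hx', hN y hy', hN (x + y) (by rw [inner_add_right, hx', hy', add_zero]),
      hN (x - y) (by rw [inner_sub_right, hx', hy', sub_zero]), map_add, map_sub] at h
    have hr2 : r ^ 2 ≠ 0 := by positivity
    apply mul_left_cancel₀ hr2
    linear_combination h
  · rintro _ ⟨y, rfl⟩ _ ⟨y', rfl⟩ h0 h0' hyy
    rw [hf] at h0 h0'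
    have hn : ‖y‖ = ‖y'‖ := by rw [hN y h0, hN y' h0', hyy]
    rw [← map_add, ← map_add]
    exact le_antisymm (norm_le_of_sections hT hK hu hy₀ hy₀u hrev h0' h0 hn.symm)
      (norm_le_of_sections hT hK hu hy₀ hy₀u hrev h0 h0' hn)

theorem exists_isRevolutionOn_range_of_affine [FiniteDimensional ℂ F]
    (hF : 2 ≤ Module.finrank ℂ F) (hT : Function.Injective T) (hK : ∀ x, x ∈ K ↔ ‖T x‖ ≤ 1)
    (hrev : IsComplexAffineBodyOfRevolution K) :
    ∃ f, IsRevolutionOn (LinearMap.range T) f := by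
  obtain ⟨g, K₀, hK₀, rfl⟩ := hrev
  have hsym := hK₀.2.2.2.1
  have hgK : ∀ x, x ∈ K₀ ↔ ‖T (g x)‖ ≤ 1 := fun x => by
    rw [← hK, g.injective.mem_set_image]
  have hgl : ∀ x, g x = g.linear x + g 0 := fun x => by
    simpa using g.map_vadd 0 x
  have hrefl : ∀ x, ‖T x‖ ≤ 1 → ‖T (x - (2 : ℂ) • g 0)‖ ≤ 1 := by
    intro x hx
    obtain ⟨x₀, rfl⟩ := g.surjective x
    have h1 := hsym.smul_mem (ξ := -1) (by simp) ((hgK x₀).2 hx)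
    rw [hgK, hgl, map_smul] at h1
    have h2 : -(g x₀ - (2 : ℂ) • g 0) = (-1 : ℂ) • g.linear x₀ + g 0 := by
      rw [hgl x₀]
      module
    rwa [← norm_neg, ← map_neg, h2]
  have hiter : ∀ k : ℕ, ‖T (-((2 * k : ℂ) • g 0))‖ ≤ 1 := by
    intro k
    induction k with
    | zero => simp
    | succ k ih =>
      convert hrefl _ ih using 3
      push_cast
      module
  have hg0 : g 0 = 0 := by
    by_contra hne
    have hpos : 0 < ‖T (g 0)‖ := norm_pos_iff.mpr (fun h => hne (hT (by rw [h, map_zero])))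
    obtain ⟨k, hk⟩ := exists_nat_gt (1 / ‖T (g 0)‖)
    rw [div_lt_iff₀ hpos] at hk
    have := hiter k
    rw [map_neg, norm_neg, map_smul, norm_smul, norm_mul, Complex.norm_natCast,
      Complex.norm_ofNat] at this
    nlinarith
  have hrange : LinearMap.range (T ∘ₗ (g.linear : F →ₗ[ℂ] F)) = LinearMap.range T :=
    LinearMap.range_comp_of_range_eq_top T (LinearEquiv.range g.linear)
  rw [← hrange]
  refine exists_isRevolutionOn_range hF (hT.comp g.linear.injective) (fun x => ?_) hK₀
  rw [hgK, hgl, hg0, add_zero]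
  rfl

end Sections

theorem isComplexEllipsoid_of_isEuclideanOn {E : Type*} [NormedAddCommGroup E]
    [InnerProductSpace ℂ E] [FiniteDimensional ℂ E] (e : E ≃ₗ[ℂ] V) {W : Submodule ℂ V}
    (hW : IsEuclideanOn W) :
    IsComplexEllipsoid
      {x : W.comap (e : E →ₗ[ℂ] V) | ‖e (x : E)‖ ≤ 1} := by
  set W' : Submodule ℂ E := W.comap (e : E →ₗ[ℂ] V) with hW'
  have : FiniteDimensional ℂ V := e.finiteDimensional
  let _ : InnerProductSpace ℂ W := InnerProductSpace.ofNorm ℂ (fun x y => by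
    have := hW x x.2 y y.2
    simp only [sq] at this
    exact this)
  let φ : W' ≃ₗ[ℂ] W := e.ofSubmodule' W
  have hφ : ∀ x : W', ‖e (x : E)‖ = ‖φ x‖ := fun x => rfl
  let ι : W' ≃ₗᵢ[ℂ] W :=
    (stdOrthonormalBasis ℂ W').equiv (stdOrthonormalBasis ℂ W) (finCongr φ.finrank_eq)
  let ψ : W' ≃ₗ[ℂ] W' := ι.toLinearEquiv.trans φ.symm
  have hψ : ∀ x : W', ‖e ((ψ x : W') : E)‖ = ‖x‖ := fun x => by
    rw [hφ]
    simp [ψ]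
  refine ⟨ψ.toAffineEquiv, ?_⟩
  ext x
  obtain ⟨y, rfl⟩ := ψ.surjective x
  have h1 : (ψ.toAffineEquiv : W' → W') = ψ := rfl
  rw [h1, ψ.injective.mem_set_image, Set.mem_ofPred_eq, hψ, mem_closedBall_zero_iff]

end Transfer

/-- let `n ≥ 4` and let `B ⊆ ℂ^{n+1}` be a complex symmetric convex body
with center at the origin, all of whose complex hyperplane sections through the origin
are complex affine bodies of revolution (inside the respective complex hyperplane).
Then some complex hyperplane section of `B` through the origin is a complex ellipsoid. -/
theorem complex_sections_bodies_of_revolution_implies_elliptical_section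
    (n : ℕ) (hn : 4 ≤ n)
    (B : Set (EuclideanSpace ℂ (Fin (n + 1))))
    (hBcompact : IsCompact B) (hBconv : Convex ℝ B) (hBint : (interior B).Nonempty)
    (hBsym : IsComplexSymmetric B)
    (hsec : ∀ H : Submodule ℂ (EuclideanSpace ℂ (Fin (n + 1))), Module.finrank ℂ H = n →
      IsComplexAffineBodyOfRevolution {x : H | (x : EuclideanSpace ℂ (Fin (n + 1))) ∈ B}) :
    ∃ H₀ : Submodule ℂ (EuclideanSpace ℂ (Fin (n + 1))), Module.finrank ℂ H₀ = n ∧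
      IsComplexEllipsoid {x : H₀ | (x : EuclideanSpace ℂ (Fin (n + 1))) ∈ B} := by
  obtain ⟨V, _, _, e, he⟩ := exists_norm_le_one_iff_mem hBcompact hBconv hBint hBsym
  have : FiniteDimensional ℂ V := e.finiteDimensional
  have hV : Module.finrank ℂ V = n + 1 := by
    rw [← e.finrank_eq, finrank_euclideanSpace_fin]
  have hcomap : ∀ H : Submodule ℂ V,
      Module.finrank ℂ (H.comap (e : EuclideanSpace ℂ (Fin (n + 1)) →ₗ[ℂ] V)) =
        Module.finrank ℂ H := fun H => (e.ofSubmodule' H).finrank_eq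
  obtain ⟨W, hWn, hW⟩ := exists_isEuclideanOn_of_forall_isRevolutionOn hn hV (fun H hH => by
    set H' := H.comap (e : EuclideanSpace ℂ (Fin (n + 1)) →ₗ[ℂ] V) with hH'
    have hn' : Module.finrank ℂ H' = n := (hcomap H).trans hH
    have hrange : LinearMap.range ((e : EuclideanSpace ℂ (Fin (n + 1)) →ₗ[ℂ] V) ∘ₗ H'.subtype)
        = H := by
      rw [LinearMap.range_comp, Submodule.range_subtype, hH']
      exact Submodule.map_comap_eq_of_surjective e.surjective H
    obtain ⟨f, hf⟩ := exists_isRevolutionOn_range_of_affine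
      (T := (e : EuclideanSpace ℂ (Fin (n + 1)) →ₗ[ℂ] V) ∘ₗ H'.subtype)
      (by omega) (e.injective.comp H'.injective_subtype) (fun x => he x) (hsec H' hn')
    exact ⟨f, hrange ▸ hf⟩)
  refine ⟨_, (hcomap W).trans hWn, ?_⟩
  simp only [he]
  exact isComplexEllipsoid_of_isEuclideanOn e hW
end

section
/- (Aleksandrov's projection theorem) Let n ≥ 2 and let B ⊂ ℝ^{n+1} be a convex body that is symmetric about the origin (B = -B). If there is a constant c such that for every unit vector v ∈ ℝ^{n+1} the n-dimensional volume (n-dimensional Hausdorff measure) of the orthogonal projection of B onto the hyperplane v^⊥ equals c, then B is a closed Euclidean ball centered at the origin. -/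
open Metric MeasureTheory
open scoped ENNReal RealInnerProductSpace

section Density

lemma choose_half_ne_zero (k : ℕ) : Ring.choose (1 / 2 : ℝ) k ≠ 0 := by
  rw [Ring.choose_eq_smul, Polynomial.descPochhammer_smeval_eq_ascPochhammer,
    Polynomial.ascPochhammer_smeval_cast, Polynomial.ascPochhammer_smeval_eq_eval]
  refine smul_ne_zero (by positivity) ?_
  rw [ne_eq, ascPochhammer_eval_eq_zero_iff]
  rintro ⟨j, -, hj⟩
  have h : 2 * (j : ℝ) + 3 = 2 * k := by linarith
  have h' : 2 * j + 3 = 2 * k := by exact_mod_cast h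
  omega

/-- If the coefficients of a convergent power series in a normed space sum to zero near the origin,
then they vanish. -/
lemma eq_zero_of_hasSum_pow_smul {F : Type*} [NormedAddCommGroup F] [NormedSpace ℝ F] {y : ℕ → F}
    (h : ∀ t : ℝ, |t| < 1 → HasSum (fun k => t ^ k • y k) 0) (k : ℕ) : y k = 0 := by
  let p : FormalMultilinearSeries ℝ ℝ F := fun k => ContinuousMultilinearMap.mkPiRing ℝ (Fin k) (y k)
  have hp : HasFPowerSeriesAt (0 : ℝ → F) p 0 := by
    rw [hasFPowerSeriesAt_iff]
    filter_upwards [ball_mem_nhds (0 : ℝ) one_pos] with t ht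
    simpa [p, FormalMultilinearSeries.coeff] using h t (by simpa using ht)
  have := congrArg (fun q : FormalMultilinearSeries ℝ ℝ F => q.coeff k) hp.eq_zero
  simpa [p, FormalMultilinearSeries.coeff] using this

/-- A closed subspace of `C(X, ℝ)` containing `√(1 + t g)` for all small `t` contains all powers
of `g`. -/
lemma pow_mem_of_sqrt_mem {X : Type*} [TopologicalSpace X] [CompactSpace X]
    (M : Submodule ℝ C(X, ℝ)) (hM : IsClosed (M : Set C(X, ℝ))) (g : C(X, ℝ)) (hg : ‖g‖ ≤ 1)
    (h : ∀ t : ℝ, |t| < 1 → ∀ f : C(X, ℝ), (∀ x, f x = √(1 + t * g x)) → f ∈ M) (k : ℕ) :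
    g ^ k ∈ M := by
  have : IsClosed (M : Set C(X, ℝ)) := hM
  have hle : ∀ x, |g x| ≤ 1 := fun x => (g.norm_coe_le_norm x).trans hg
  have key : Ring.choose (1 / 2 : ℝ) k • M.mkQL (g ^ k) = 0 := by
    refine eq_zero_of_hasSum_pow_smul
      (y := fun k => Ring.choose (1 / 2 : ℝ) k • M.mkQL (g ^ k)) (fun t ht => ?_) k
    have hsum : Summable fun k : ℕ => t ^ k • Ring.choose (1 / 2 : ℝ) k • g ^ k := by
      have hs := (binomialSeries ℝ (1 / 2 : ℝ)).summable_norm_apply (x := t) (by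
        refine eball_subset_eball binomialSeries_radius_ge_one ?_
        simpa [← ofReal_norm] using ht)
      refine Summable.of_norm_bounded hs fun k => ?_
      rw [norm_smul, norm_smul, binomialSeries_apply]
      simp only [norm_smul, List.ofFn_const, List.prod_replicate]
      have : ‖g ^ k‖ ≤ 1 := by
        refine (ContinuousMap.norm_le _ zero_le_one).2 fun x => ?_
        simpa using pow_le_one₀ (abs_nonneg _) (hle x)
      calc _ ≤ ‖t ^ k‖ * (‖Ring.choose (1 / 2 : ℝ) k‖ * 1) := by gcongr
        _ = _ := by ring
    obtain ⟨f, hf⟩ := hsum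
    have hfM : f ∈ M := by
      refine h t ht f fun x => ?_
      have h1 : HasSum (fun k : ℕ => t ^ k * (Ring.choose (1 / 2 : ℝ) k * g x ^ k)) (f x) := by
        simpa using (ContinuousMap.evalCLM ℝ x).hasSum hf
      have h2 := Real.one_add_rpow_hasFPowerSeriesOnBall_zero (a := 1 / 2).hasSum
        (y := t * g x) (by
          have : |t * g x| < 1 := by
            rw [abs_mul]
            exact (mul_le_of_le_one_right (abs_nonneg t) (hle x)).trans_lt ht
          rw [mem_eball_zero_iff, ← ofReal_norm, ENNReal.ofReal_lt_one]
          exact this)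
      rw [Real.sqrt_eq_rpow]
      refine h1.unique ?_
      convert! h2 using 1
      · ext k
        rw [binomialSeries_apply, List.ofFn_const, List.prod_replicate, smul_eq_mul]
        ring
      · simp
    have := M.mkQL.hasSum hf
    simpa [(Submodule.Quotient.mk_eq_zero M).2 hfM] using this
  rw [smul_eq_zero_iff_right (choose_half_ne_zero k)] at key
  exact (Submodule.Quotient.mk_eq_zero M).1 key

lemma eqOn_zero_of_integral_ball_nonpos {E : Type*} [NormedAddCommGroup E] [NormedSpace ℝ E]
    [FiniteDimensional ℝ E] [MeasurableSpace E] [BorelSpace E] (μ : Measure E) [μ.IsAddHaarMeasure]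
    {g : E → ℝ} (hg : Continuous g) (h0 : ∀ x, 0 ≤ g x) (hint : ∫ x in ball 0 1, g x ∂μ ≤ 0) :
    ∀ x ∈ ball (0 : E) 1, g x = 0 := by
  have hi : IntegrableOn g (ball 0 1) μ :=
    (hg.continuousOn.integrableOn_compact (isCompact_closedBall 0 1)).mono_set ball_subset_closedBall
  have h1 : ∫ x in ball 0 1, g x ∂μ = 0 := le_antisymm hint (integral_nonneg h0)
  rw [setIntegral_eq_zero_iff_of_nonneg_ae (.of_forall h0) hi] at h1
  exact Measure.eqOn_open_of_ae_eq h1 isOpen_ball hg.continuousOn continuousOn_const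

section Euclidean

variable {E : Type*} [NormedAddCommGroup E] [InnerProductSpace ℝ E]

/-- The function `u ↦ |⟪u, y⟫|` on the unit sphere, i.e. the support function of the segment
`[-y, y]`. -/
noncomputable def absInner (y : E) : C(sphere (0 : E) 1, ℝ) :=
  ⟨fun u => |⟪(u : E), y⟫|, by fun_prop⟩

@[simp]
lemma absInner_apply (y : E) (u : sphere (0 : E) 1) : absInner y u = |⟪(u : E), y⟫| := rfl

lemma continuous_absInner : Continuous (absInner : E → C(sphere (0 : E) 1, ℝ)) := by
  refine ContinuousMap.continuous_of_continuous_uncurry _ ?_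
  change Continuous fun p : E × sphere (0 : E) 1 => |⟪(p.2 : E), p.1⟫|
  fun_prop

variable (E) in
/-- The closed span of the functions `|⟪·, y⟫|`. -/
noncomputable def absInnerSpan : Submodule ℝ C(sphere (0 : E) 1, ℝ) :=
  (Submodule.span ℝ (Set.range absInner)).topologicalClosure

lemma isClosed_absInnerSpan : IsClosed (absInnerSpan E : Set C(sphere (0 : E) 1, ℝ)) :=
  Submodule.isClosed_topologicalClosure _

lemma closure_span_exp_inner [CompactSpace (sphere (0 : E) 1)]
    (N : Submodule ℝ C(sphere (0 : E) 1, ℝ)) (hN : IsClosed (N : Set C(sphere (0 : E) 1, ℝ)))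
    (h : ∀ (b : E) (f : C(sphere (0 : E) 1, ℝ)), (∀ u, f u = Real.exp ⟪(u : E), b⟫) → f ∈ N)
    (f : C(sphere (0 : E) 1, ℝ)) : f ∈ N := by
  let φ : Multiplicative E →* C(sphere (0 : E) 1, ℝ) :=
    { toFun := fun b => ⟨fun u => Real.exp ⟪(u : E), b.toAdd⟫, by fun_prop⟩
      map_one' := by ext u; simp
      map_mul' := fun a b => by ext u; simp [inner_add_right, Real.exp_add] }
  let A : Subalgebra ℝ C(sphere (0 : E) 1, ℝ) := Algebra.adjoin ℝ (MonoidHom.mrange φ)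
  have hsep : A.SeparatesPoints := by
    intro x y hxy
    refine ⟨_, ⟨φ (.ofAdd ((x : E) - y)), Algebra.subset_adjoin ⟨_, rfl⟩, rfl⟩, fun heq => hxy ?_⟩
    have h1 : ⟪(x : E), x - y⟫ = ⟪(y : E), x - y⟫ := by simpa [φ] using heq
    have h2 : ⟪(x : E) - y, x - y⟫ = 0 := by rw [inner_sub_left, h1, sub_self]
    exact Subtype.ext (sub_eq_zero.1 (inner_self_eq_zero.1 h2))
  have hA : (A : Set C(sphere (0 : E) 1, ℝ)) ⊆ N := by
    have : Subalgebra.toSubmodule A ≤ N := by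
      rw [Algebra.adjoin_eq_span, Submonoid.closure_eq, Submodule.span_le]
      rintro _ ⟨b, rfl⟩
      exact h b.toAdd _ fun _ => rfl
    exact this
  have := ContinuousMap.continuousMap_mem_subalgebra_closure_of_separatesPoints A hsep f
  exact closure_minimal hA hN this

variable [FiniteDimensional ℝ E] [MeasurableSpace E] [BorelSpace E]

lemma integral_ball_comp_linearIsometryEquiv (R : E ≃ₗᵢ[ℝ] E) (f : E → ℝ) :
    ∫ x in ball 0 1, f (R x) = ∫ x in ball (0 : E) 1, f x := by
  have h := R.measurePreserving.setIntegral_preimage_emb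
    R.toHomeomorph.measurableEmbedding f (ball 0 1)
  rwa [R.preimage_ball, map_zero] at h

lemma exists_integral_abs_inner [Nontrivial E] :
    ∃ κ : ℝ, 0 < κ ∧ ∀ y : E, ∫ x in ball (0 : E) 1, |⟪y, x⟫| = κ * ‖y‖ := by
  obtain ⟨e, he⟩ := exists_norm_eq E zero_le_one
  have hunit : ∀ v : E, ‖v‖ = 1 →
      ∫ x in ball (0 : E) 1, |⟪v, x⟫| = ∫ x in ball (0 : E) 1, |⟪e, x⟫| := fun v hv => by
    rw [← integral_ball_comp_linearIsometryEquiv (Submodule.reflection (ℝ ∙ (e - v))ᗮ)]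
    congr! 3 with x
    have h := LinearIsometryEquiv.inner_map_map (Submodule.reflection (ℝ ∙ (e - v))ᗮ) e x
    rwa [Submodule.reflection_sub (he.trans hv.symm)] at h
  refine ⟨∫ x in ball (0 : E) 1, |⟪e, x⟫|, ?_, fun y => ?_⟩
  · by_contra! h
    have := eqOn_zero_of_integral_ball_nonpos volume (g := fun x : E => |⟪e, x⟫|) (by fun_prop)
      (fun _ => abs_nonneg _) h ((1 / 2 : ℝ) • e) (by simp [norm_smul, he]; norm_num)
    simp [inner_smul_right, he] at this
  · rcases eq_or_ne y 0 with rfl | hy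
    · simp
    · rw [← hunit (‖y‖⁻¹ • y) (by simp [norm_smul, hy]), mul_comm, ← integral_const_mul]
      congr with x
      rw [inner_smul_left, abs_mul]
      simp [hy]

/-- Ellipsoids are zonoids. -/
lemma norm_symmetric_mem_absInnerSpan [Nontrivial E] (A : E →L[ℝ] E)
    (hA : ∀ x y, ⟪A x, y⟫ = ⟪x, A y⟫)
    (f : C(sphere (0 : E) 1, ℝ)) (hf : ∀ u, f u = ‖A u‖) : f ∈ absInnerSpan E := by
  obtain ⟨κ, hκ, hint⟩ := exists_integral_abs_inner (E := E)
  have hc : Continuous fun x => absInner (A x) := continuous_absInner.comp A.continuous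
  have hi : IntegrableOn (fun x => absInner (A x)) (ball (0 : E) 1) :=
    (hc.continuousOn.integrableOn_compact (isCompact_closedBall 0 1)).mono_set ball_subset_closedBall
  have hfin : volume (ball (0 : E) 1) ≠ ∞ := measure_ball_lt_top.ne
  have hpos : volume (ball (0 : E) 1) ≠ 0 := (measure_ball_pos _ _ one_pos).ne'
  have hmem := (absInnerSpan E).convex.set_average_mem isClosed_absInnerSpan hpos hfin
    (Filter.Eventually.of_forall fun x => Submodule.le_topologicalClosure _
      (Submodule.subset_span ⟨A x, rfl⟩)) hi
  have hint' : ∫ x in ball (0 : E) 1, absInner (A x) ∈ absInnerSpan E := by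
    rw [setAverage_eq] at hmem
    have hr : volume.real (ball (0 : E) 1) ≠ 0 := (measureReal_ne_zero_iff hfin).2 hpos
    have := (absInnerSpan E).smul_mem (volume.real (ball (0 : E) 1)) hmem
    rwa [smul_inv_smul₀ hr] at this
  convert (absInnerSpan E).smul_mem κ⁻¹ hint'
  ext u
  have := (ContinuousMap.evalCLM ℝ u).integral_comp_comm hi
  simp only [ContinuousMap.evalCLM_apply] at this
  rw [ContinuousMap.smul_apply, ← this, hf]
  simp only [absInner_apply, ← hA, hint]
  rw [smul_eq_mul, inv_mul_cancel_left₀ hκ.ne']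

lemma inner_sq_pow_mem_absInnerSpan [Nontrivial E] (a : E) (ha : ‖a‖ = 1) (k : ℕ)
    (g : C(sphere (0 : E) 1, ℝ)) (hg : ∀ u, g u = ⟪(u : E), a⟫ ^ 2) : g ^ k ∈ absInnerSpan E := by
  refine pow_mem_of_sqrt_mem _ isClosed_absInnerSpan g ?_ (fun t ht f hf => ?_) k
  · refine (ContinuousMap.norm_le _ zero_le_one).2 fun u => ?_
    have := abs_real_inner_le_norm (u : E) a
    rw [hg, norm_pow, Real.norm_eq_abs]
    exact pow_le_one₀ (abs_nonneg _) (by simpa [ha] using this)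
  · let A : E →L[ℝ] E := .id ℝ E + (√(1 + t) - 1) • (innerSL ℝ a).smulRight a
    have hA : ∀ x, A x = x + (√(1 + t) - 1) • ⟪a, x⟫ • a := fun x => by simp [A]
    refine norm_symmetric_mem_absInnerSpan A (fun x y => ?_) f fun u => ?_
    · simp only [hA, inner_add_left, inner_add_right, inner_smul_left, inner_smul_right,
        real_inner_comm a x, RCLike.conj_to_real]
      ring
    · have hu : ‖(u : E)‖ = 1 := by simp
      have ht' : 0 ≤ 1 + t := by linarith [(abs_lt.1 ht).1]
      rw [hf, hg, ← Real.sqrt_sq (norm_nonneg (A u)), ← real_inner_self_eq_norm_sq]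
      congr 1
      simp only [hA, inner_add_left, inner_add_right, inner_smul_left, inner_smul_right,
        real_inner_comm a (u : E), RCLike.conj_to_real, real_inner_self_eq_norm_sq, ha, hu]
      linear_combination (-(⟪a, (u : E)⟫ ^ 2)) * Real.sq_sqrt ht'

lemma cosh_inner_mem_absInnerSpan [Nontrivial E] (b : E) (f : C(sphere (0 : E) 1, ℝ))
    (hf : ∀ u, f u = Real.cosh ⟪(u : E), b⟫) : f ∈ absInnerSpan E := by
  obtain ⟨a, r, ha, rfl⟩ : ∃ (a : E) (r : ℝ), ‖a‖ = 1 ∧ b = r • a := by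
    rcases eq_or_ne b 0 with rfl | hb
    · obtain ⟨e, he⟩ := exists_norm_eq E zero_le_one
      exact ⟨e, 0, he, by simp⟩
    · exact ⟨‖b‖⁻¹ • b, ‖b‖, by simp [norm_smul, hb], by simp [hb]⟩
  let g : C(sphere (0 : E) 1, ℝ) := ⟨fun u => ⟪(u : E), a⟫ ^ 2, by fun_prop⟩
  have hle : ∀ u, |g u| ≤ 1 := fun u => by
    have := abs_real_inner_le_norm (u : E) a
    simpa [g, ha] using this
  have hsum : Summable fun k : ℕ => (r ^ (2 * k) / (2 * k).factorial) • g ^ k := by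
    refine Summable.of_norm_bounded (Real.hasSum_cosh r).summable fun k => ?_
    have h1 : ‖g ^ k‖ ≤ 1 := by
      refine (ContinuousMap.norm_le _ zero_le_one).2 fun x => ?_
      simpa using pow_le_one₀ (abs_nonneg _) (hle x)
    have h2 : 0 ≤ r ^ (2 * k) / (2 * k).factorial := by rw [pow_mul]; positivity
    rw [norm_smul, Real.norm_of_nonneg h2]
    exact mul_le_of_le_one_right h2 h1
  obtain ⟨f', hf'⟩ := hsum
  have hff : f = f' := by
    ext u
    have h1 : HasSum (fun k : ℕ => (r ^ (2 * k) / (2 * k).factorial) * (⟪(u : E), a⟫ ^ 2) ^ k)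
        (f' u) := by
      simpa [g] using (ContinuousMap.evalCLM ℝ u).hasSum hf'
    rw [hf]
    refine HasSum.unique ?_ h1
    convert! Real.hasSum_cosh ⟪(u : E), r • a⟫ using 2 with k
    rw [inner_smul_right, mul_pow, ← pow_mul]
    ring
  rw [hff]
  exact isClosed_absInnerSpan.mem_of_tendsto hf' (.of_forall fun s =>
    sum_mem fun k _ => Submodule.smul_mem _ _ (inner_sq_pow_mem_absInnerSpan a ha k g fun _ => rfl))

/-- Even continuous functions on the sphere are uniform limits of linear combinations of the
functions `|⟪·, y⟫|`. -/
lemma even_mem_absInnerSpan [Nontrivial E] (f : C(sphere (0 : E) 1, ℝ))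
    (hf : ∀ u, f (-u) = f u) : f ∈ absInnerSpan E := by
  let neg : C(sphere (0 : E) 1, sphere (0 : E) 1) := ⟨Neg.neg, continuous_neg⟩
  let T : C(sphere (0 : E) 1, ℝ) →L[ℝ] C(sphere (0 : E) 1, ℝ) :=
    (1 / 2 : ℝ) • (.id ℝ _ +
      ⟨(ContinuousMap.compRightAlgHom ℝ ℝ neg).toLinearMap, ContinuousMap.continuous_precomp neg⟩)
  have hT : ∀ g u, T g u = 1 / 2 * (g u + g (-u)) := fun g u => rfl
  have hmem : f ∈ (absInnerSpan E).comap T.toLinearMap := by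
    refine closure_span_exp_inner ((absInnerSpan E).comap T.toLinearMap)
      (isClosed_absInnerSpan.preimage T.continuous)
      (fun b g hg => cosh_inner_mem_absInnerSpan b _ fun u => ?_) f
    change T g u = _
    rw [hT, hg, hg, Real.cosh_eq]
    simp
    ring
  convert show T f ∈ absInnerSpan E from hmem
  ext u
  rw [hT, hf]
  ring

/-- Even homogeneous continuous functions are approximated by linear combinations of the functions
`|⟪·, y⟫|`. -/
lemma exists_sum_abs_inner_near [Nontrivial E] (f : E → ℝ) (hf : Continuous f)
    (heven : ∀ x, f (-x) = f x) (hhom : ∀ (t : ℝ) x, 0 ≤ t → f (t • x) = t * f x)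
    {η : ℝ} (hη : 0 < η) :
    ∃ (s : Finset E) (a : E → ℝ), ∀ x, |f x - ∑ y ∈ s, a y * abs ⟪x, y⟫| ≤ η * ‖x‖ := by
  let F : C(sphere (0 : E) 1, ℝ) := ⟨fun u => f u, by fun_prop⟩
  have hF : F ∈ absInnerSpan E := even_mem_absInnerSpan F fun u => heven u
  obtain ⟨G, hG, hd⟩ := Metric.mem_closure_iff.1 hF η hη
  obtain ⟨c, rfl⟩ := Finsupp.mem_span_range_iff_exists_finsupp.1 hG
  refine ⟨c.support, c, fun x => ?_⟩
  rcases eq_or_ne x 0 with rfl | hx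
  · simpa using hhom 0 0 le_rfl
  have hx' : ‖x‖ ≠ 0 := norm_ne_zero_iff.2 hx
  let u : sphere (0 : E) 1 := ⟨‖x‖⁻¹ • x, by simp [norm_smul, hx]⟩
  have hu : x = ‖x‖ • (u : E) := by simp [u, hx]
  have h1 := (ContinuousMap.dist_apply_le_dist u).trans hd.le
  rw [Real.dist_eq, Finsupp.sum, ContinuousMap.sum_apply] at h1
  simp only [ContinuousMap.smul_apply, absInner_apply, smul_eq_mul] at h1
  have h2 : f x - ∑ y ∈ c.support, c y * abs ⟪x, y⟫ =
      ‖x‖ * (F u - ∑ y ∈ c.support, c y * abs ⟪(u : E), y⟫) := by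
    rw [mul_sub, Finset.mul_sum]
    congr 1
    · conv_lhs => rw [hu, hhom _ _ (norm_nonneg x)]
      rfl
    · refine Finset.sum_congr rfl fun y _ => ?_
      conv_lhs => rw [hu, inner_smul_left, abs_mul]
      simp
      ring
  rw [h2, abs_mul, abs_norm, mul_comm]
  gcongr

end Euclidean
end Density

section Fubini

open scoped Pointwise

variable {E : Type*} [NormedAddCommGroup E] [InnerProductSpace ℝ E]

/-- The intersection of `L` with the line through `y` in direction `v`, seen as a set of reals. -/
def lineFiber (v : E) (L : Set E) (y : E) : Set ℝ := {t | y + t • v ∈ L}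

/-- The orthogonal projection of `L` to the hyperplane orthogonal to `v`. -/
def shadow (v : E) (L : Set E) : Set (ℝ ∙ v)ᗮ := {y | (lineFiber v L y).Nonempty}

/-- The segment `[-y, y]`. -/
def symmSegment (y : E) : Set E := (fun t : ℝ => t • y) '' Set.Icc (-1) 1

lemma isCompact_symmSegment (y : E) : IsCompact (symmSegment y) :=
  isCompact_Icc.image (by fun_prop)

lemma convex_symmSegment (y : E) : Convex ℝ (symmSegment y) :=
  (convex_Icc _ _).is_linear_image (LinearMap.toSpanSingleton ℝ E y).isLinear

lemma zero_mem_symmSegment (y : E) : 0 ∈ symmSegment y := ⟨0, by simp⟩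

lemma shadow_mono {v : E} {L L' : Set E} (h : L ⊆ L') : shadow v L ⊆ shadow v L' :=
  fun _ ⟨t, ht⟩ => ⟨t, h ht⟩

lemma shadow_image_coe {v : E} (hv : ‖v‖ = 1) (L : Set E) :
    ((↑) : (ℝ ∙ v)ᗮ → E) '' shadow v L = (fun x => x - ⟪x, v⟫ • v) '' L := by
  ext x
  constructor
  · rintro ⟨y, ⟨t, ht⟩, rfl⟩
    have hy : ⟪(y : E), v⟫ = 0 := Submodule.mem_orthogonal_singleton_iff_inner_left.1 y.2
    refine ⟨_, ht, ?_⟩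
    simp [inner_add_left, hy, inner_smul_left, hv]
  · rintro ⟨z, hz, rfl⟩
    refine ⟨⟨z - ⟪z, v⟫ • v, ?_⟩, ⟨⟪z, v⟫, ?_⟩, rfl⟩
    · rw [Submodule.mem_orthogonal_singleton_iff_inner_left]
      simp [inner_sub_left, inner_smul_left, hv]
    · simpa [lineFiber] using hz

lemma isCompact_shadow {v : E} (hv : ‖v‖ = 1) {L : Set E} (hL : IsCompact L) :
    IsCompact (shadow v L) := by
  rw [Subtype.isCompact_iff, shadow_image_coe hv]
  exact hL.image (by fun_prop)

lemma isCompact_lineFiber {v : E} (hv : v ≠ 0) {L : Set E} (hL : IsCompact L) (y : E) :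
    IsCompact (lineFiber v L y) := by
  have h : Topology.IsClosedEmbedding fun t : ℝ => y + t • v :=
    (Homeomorph.addLeft y).isClosedEmbedding.comp
      (isClosedEmbedding_smul_left hv)
  exact h.isCompact_preimage hL

lemma convex_lineFiber (v : E) {L : Set E} (hL : Convex ℝ L) (y : E) :
    Convex ℝ (lineFiber v L y) := by
  intro s hs t ht a b ha hb hab
  have := hL hs ht ha hb hab
  simp only [lineFiber, Set.mem_ofPred_eq] at *
  convert this using 1
  rw [smul_add, smul_add, add_add_add_comm, ← add_smul, hab, one_smul, smul_smul, smul_smul,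
    ← add_smul]
  simp

lemma exists_lineFiber_eq_Icc {v : E} (hv : v ≠ 0) {L : Set E} (hL : IsCompact L)
    (hc : Convex ℝ L) {y : E} (hy : (lineFiber v L y).Nonempty) :
    ∃ a b, a ≤ b ∧ lineFiber v L y = Set.Icc a b := by
  have hK := isCompact_lineFiber hv hL y
  refine ⟨_, _, ?_, eq_Icc_of_connected_compact
    ⟨hy, (convex_lineFiber v hc y).isPreconnected⟩ hK⟩
  exact (csInf_le hK.bddBelow hy.choose_spec).trans (le_csSup hK.bddAbove hy.choose_spec)

lemma lineFiber_add_symmSegment (v : E) (L : Set E) (y : E) {r : ℝ} :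
    lineFiber v (L + symmSegment (r • v)) y =
      lineFiber v L y + (fun t => t * r) '' Set.Icc (-1) 1 := by
  ext t
  simp only [lineFiber, symmSegment, Set.mem_add, Set.mem_ofPred_eq, Set.exists_mem_image]
  constructor
  · rintro ⟨x, hx, s, hs, h⟩
    refine ⟨t - s * r, ?_, s, hs, by ring⟩
    convert hx using 1
    rw [sub_smul, ← add_sub_assoc, ← h, mul_smul, add_sub_cancel_right]
  · rintro ⟨x, hx, s, hs, rfl⟩
    exact ⟨_, hx, s, hs, by rw [add_smul, mul_smul, add_assoc]⟩

variable [FiniteDimensional ℝ E] [MeasurableSpace E] [BorelSpace E]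

lemma volume_eq_lintegral_lineFiber {v : E} (hv : ‖v‖ = 1) {L : Set E} (hL : MeasurableSet L) :
    volume L = ∫⁻ y : (ℝ ∙ v)ᗮ, volume (lineFiber v L y) := by
  have h := (ℝ ∙ v).measurePreserving_measurableEquivProd (0 : E)
  rw [InnerProductSpace.euclideanHausdorffMeasure_eq_volume] at h
  rw [← h.symm.measure_preimage_equiv, Measure.volume_eq_prod,
    Measure.prod_apply_symm (hL.preimage (MeasurableEquiv.measurable _))]
  congr with y
  rw [← (LinearIsometryEquiv.toSpanUnitSingleton v hv).measurePreserving.measure_preimage_emb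
    (LinearIsometryEquiv.toSpanUnitSingleton v hv).toHomeomorph.measurableEmbedding]
  congr 1
  ext t
  simp [lineFiber, add_comm]

lemma volume_add_symmSegment {v : E} (hv : ‖v‖ = 1) {r : ℝ} (hr : 0 ≤ r) {L : Set E}
    (hL : IsCompact L) (hc : Convex ℝ L) :
    volume (L + symmSegment (r • v)) =
      volume L + ENNReal.ofReal (2 * r) * volume (shadow v L) := by
  have hv0 : v ≠ 0 := fun h => by simp [h] at hv
  rw [volume_eq_lintegral_lineFiber hv (hL.add (isCompact_symmSegment _)).measurableSet,
    volume_eq_lintegral_lineFiber hv hL.measurableSet,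
    ← lintegral_indicator_const (isCompact_shadow hv hL).measurableSet,
    ← lintegral_add_right _ (measurable_const.indicator (isCompact_shadow hv hL).measurableSet)]
  congr with y
  have himg : (fun t => t * r) '' Set.Icc (-1) 1 = Set.Icc (-r) r := by
    rcases hr.eq_or_lt with rfl | hr
    · ext x
      simp only [mul_zero, neg_zero, Set.Icc_self, Set.mem_singleton_iff, Set.mem_image]
      exact ⟨fun ⟨_, _, h⟩ => h.symm, fun h => ⟨0, by simp [h]⟩⟩
    · rw [Set.image_mul_right_Icc (by norm_num) hr.le]
      simp
  rw [lineFiber_add_symmSegment, himg]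
  by_cases hy : (lineFiber v L y).Nonempty
  · obtain ⟨a, b, hab, h⟩ := exists_lineFiber_eq_Icc hv0 hL hc hy
    rw [Set.indicator_of_mem (show y ∈ shadow v L from hy), h,
      Set.Icc_add_Icc hab (by linarith), Real.volume_Icc, Real.volume_Icc,
      ← ENNReal.ofReal_add (by linarith) (by linarith)]
    congr 1
    ring
  · rw [Set.indicator_of_notMem (show y ∉ shadow v L from hy),
      Set.not_nonempty_iff_eq_empty.1 hy]
    simp

lemma volume_shadow {n : ℕ} (hn : Module.finrank ℝ E = n + 1) {v : E} (hv : ‖v‖ = 1)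
    (L : Set E) : volume (shadow v L) = μHE[n] ((fun x => x - ⟪x, v⟫ • v) '' L) := by
  have hv0 : v ≠ 0 := fun h => by simp [h] at hv
  have hfin : Module.finrank ℝ (ℝ ∙ v)ᗮ = n := by
    have := (ℝ ∙ v).finrank_add_finrank_orthogonal
    rw [finrank_span_singleton hv0] at this
    omega
  rw [← InnerProductSpace.euclideanHausdorffMeasure_eq_volume, hfin, ← shadow_image_coe hv]
  exact (isometry_subtype_coe.euclideanHausdorffMeasure_image _).symm

end Fubini

section SupportFunction

open scoped Pointwise

variable {E : Type*} [NormedAddCommGroup E] [InnerProductSpace ℝ E] {B : Set E}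

/-- The support function of a set. -/
noncomputable def suppFun (B : Set E) (x : E) : ℝ := sSup ((fun p => ⟪p, x⟫) '' B)

lemma exists_inner_eq_suppFun (hB : IsCompact B) (hne : B.Nonempty) (x : E) :
    ∃ p ∈ B, ⟪p, x⟫ = suppFun B x :=
  (hB.image (f := fun p => ⟪p, x⟫) (by fun_prop)).sSup_mem (hne.image _)

lemma inner_le_suppFun (hB : IsCompact B) (x : E) {p : E} (hp : p ∈ B) : ⟪p, x⟫ ≤ suppFun B x :=
  le_csSup (hB.image (f := fun p => ⟪p, x⟫) (by fun_prop)).bddAbove ⟨p, hp, rfl⟩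

lemma continuous_suppFun (hB : IsCompact B) : Continuous (suppFun B) :=
  hB.continuous_sSup (f := fun x p => ⟪p, x⟫) (by unfold Function.HasUncurry.uncurry; fun_prop)

lemma suppFun_smul (B : Set E) {t : ℝ} (ht : 0 ≤ t) (x : E) :
    suppFun B (t • x) = t * suppFun B x := by
  rw [suppFun, suppFun, ← smul_eq_mul, ← Real.sSup_smul_of_nonneg ht, ← Set.image_smul,
    Set.image_image]
  simp [inner_smul_right]

lemma suppFun_neg (h : B = -B) (x : E) : suppFun B (-x) = suppFun B x := by
  conv_lhs => rw [suppFun, h, ← Set.image_neg_eq_neg, Set.image_image]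
  simp [suppFun]

/-- A point which no linear functional separates from the compact convex set `L` belongs to `L`. -/
lemma mem_of_forall_exists_inner_le [CompleteSpace E] {L : Set E} (hL : IsCompact L)
    (hc : Convex ℝ L) {z : E} (h : ∀ x, ∃ w ∈ L, ⟪z, x⟫ ≤ ⟪w, x⟫) : z ∈ L := by
  by_contra hz
  obtain ⟨f, u, h1, h2⟩ := geometric_hahn_banach_closed_point hc hL.isClosed hz
  obtain ⟨w, hw, hle⟩ := h ((InnerProductSpace.toDual ℝ E).symm f)
  rw [real_inner_comm, real_inner_comm _ w, InnerProductSpace.toDual_symm_apply,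
    InnerProductSpace.toDual_symm_apply] at hle
  linarith [h1 w hw]

/-- The zonotope with generators `a y • y`, `y ∈ s`. -/
def zonotope (s : Finset E) (a : E → ℝ) : Set E := ∑ y ∈ s, symmSegment (a y • y)

lemma zonotope_insert [DecidableEq E] {s : Finset E} {y : E} (hy : y ∉ s) (a : E → ℝ) :
    zonotope (insert y s) a = symmSegment (a y • y) + zonotope s a :=
  Finset.sum_insert hy

lemma isCompact_zonotope (s : Finset E) (a : E → ℝ) : IsCompact (zonotope s a) := by
  classical
  induction s using Finset.induction_on with
  | empty => exact isCompact_singleton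
  | insert y s hy ih => rw [zonotope_insert hy]; exact (isCompact_symmSegment _).add ih

lemma convex_zonotope (s : Finset E) (a : E → ℝ) : Convex ℝ (zonotope s a) := by
  classical
  induction s using Finset.induction_on with
  | empty => exact convex_singleton 0
  | insert y s hy ih => rw [zonotope_insert hy]; exact (convex_symmSegment _).add ih

lemma zero_mem_zonotope (s : Finset E) (a : E → ℝ) : 0 ∈ zonotope s a := by
  classical
  induction s using Finset.induction_on with
  | empty => exact rfl
  | insert y s hy ih =>
    rw [zonotope_insert hy]
    exact ⟨0, zero_mem_symmSegment _, 0, ih, add_zero 0⟩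

lemma inner_le_of_mem_zonotope {s : Finset E} {a : E → ℝ} (ha : ∀ y, 0 ≤ a y) {z : E}
    (hz : z ∈ zonotope s a) (x : E) : ⟪z, x⟫ ≤ ∑ y ∈ s, a y * |⟪x, y⟫| := by
  classical
  induction s using Finset.induction_on generalizing z with
  | empty =>
    obtain rfl : z = 0 := hz
    simp
  | insert y s hy ih =>
    rw [zonotope_insert hy] at hz
    obtain ⟨_, ⟨t, ht, rfl⟩, w, hw, rfl⟩ := hz
    rw [Finset.sum_insert hy]
    simp only [inner_add_left, inner_smul_left, RCLike.conj_to_real]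
    refine add_le_add ?_ (ih hw)
    calc t * (a y * ⟪y, x⟫) ≤ |t * (a y * ⟪y, x⟫)| := le_abs_self _
      _ = |t| * (a y * |⟪x, y⟫|) := by rw [abs_mul, abs_mul, abs_of_nonneg (ha y), real_inner_comm]
      _ ≤ _ := mul_le_of_le_one_left (mul_nonneg (ha y) (abs_nonneg _)) (abs_le.2 ht)

lemma exists_mem_zonotope_inner_eq (s : Finset E) (a : E → ℝ) (x : E) :
    ∃ z ∈ zonotope s a, ⟪z, x⟫ = ∑ y ∈ s, a y * |⟪x, y⟫| := by
  classical
  induction s using Finset.induction_on with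
  | empty => exact ⟨0, rfl, by simp⟩
  | insert y s hy ih =>
    obtain ⟨w, hw, h⟩ := ih
    rw [zonotope_insert hy]
    refine ⟨_, ⟨_, ⟨SignType.sign ⟪x, y⟫, ?_, rfl⟩, w, hw, rfl⟩, ?_⟩
    · rcases lt_trichotomy ⟪x, y⟫ 0 with h | h | h <;> simp [h]
    · rw [Finset.sum_insert hy]
      simp only [inner_add_left, inner_smul_left, RCLike.conj_to_real, h, real_inner_comm x y]
      rw [← sign_mul_self ⟪x, y⟫]
      ring

lemma norm_le_of_mem_zonotope {s : Finset E} {a : E → ℝ} (ha : ∀ y, 0 ≤ a y) {z : E}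
    (hz : z ∈ zonotope s a) : ‖z‖ ≤ ∑ y ∈ s, a y * ‖y‖ := by
  rcases eq_or_ne z 0 with rfl | h0
  · rw [norm_zero]
    exact Finset.sum_nonneg fun y _ => mul_nonneg (ha y) (norm_nonneg y)
  have h0' : 0 < ‖z‖ := norm_pos_iff.2 h0
  refine le_of_mul_le_mul_left ?_ h0'
  rw [← real_inner_self_eq_norm_mul_norm, Finset.mul_sum]
  refine (inner_le_of_mem_zonotope ha hz z).trans (Finset.sum_le_sum fun y _ => ?_)
  calc a y * |⟪z, y⟫| ≤ a y * (‖z‖ * ‖y‖) :=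
        mul_le_mul_of_nonneg_left (abs_real_inner_le_norm z y) (ha y)
    _ = _ := by ring

lemma exists_unit_smul_eq [Nontrivial E] (y : E) (a : ℝ) :
    ∃ v : E, ‖v‖ = 1 ∧ a • y = (a * ‖y‖) • v := by
  rcases eq_or_ne y 0 with rfl | hy
  · obtain ⟨e, he⟩ := exists_norm_eq E zero_le_one
    exact ⟨e, he, by simp⟩
  · exact ⟨‖y‖⁻¹ • y, by simp [norm_smul, hy], by simp [smul_smul, hy]⟩

end SupportFunction

section MixedVolume

open scoped Pointwise

variable {E : Type*} [NormedAddCommGroup E] [InnerProductSpace ℝ E] [FiniteDimensional ℝ E]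
  [MeasurableSpace E] [BorelSpace E] {B : Set E} {C : ℝ}

lemma measureReal_add_symmSegment {v : E} (hv : ‖v‖ = 1) {r : ℝ} (hr : 0 ≤ r) {L : Set E}
    (hL : IsCompact L) (hc : Convex ℝ L) :
    volume.real (L + symmSegment (r • v)) =
      volume.real L + 2 * r * volume.real (shadow v L) := by
  rw [measureReal_def, volume_add_symmSegment hv hr hL hc, ENNReal.toReal_add hL.measure_ne_top
    (ENNReal.mul_ne_top ENNReal.ofReal_ne_top (isCompact_shadow hv hL).measure_ne_top),
    ENNReal.toReal_mul, ENNReal.toReal_ofReal (by positivity)]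
  rfl

lemma measureReal_shadow_mono {v : E} (hv : ‖v‖ = 1) {L L' : Set E} (hL' : IsCompact L')
    (h : L ⊆ L') : volume.real (shadow v L) ≤ volume.real (shadow v L') :=
  measureReal_mono (shadow_mono h) (isCompact_shadow hv hL').measure_ne_top

lemma measureReal_shadow_smul {v : E} (hv : ‖v‖ = 1) {t : ℝ} (ht : 0 < t) (L : Set E) :
    volume.real (shadow v (t • L)) =
      t ^ (Module.finrank ℝ E - 1) * volume.real (shadow v L) := by
  have hv0 : v ≠ 0 := fun h => by simp [h] at hv
  have h : shadow v (t • L) = t • shadow v L := by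
    ext y
    rw [Set.mem_smul_set_iff_inv_smul_mem₀ ht.ne']
    constructor
    · rintro ⟨r, hr⟩
      refine ⟨t⁻¹ * r, ?_⟩
      have := (Set.mem_smul_set_iff_inv_smul_mem₀ ht.ne' _ _).1 hr
      simpa [lineFiber, smul_smul] using this
    · rintro ⟨r, hr⟩
      refine ⟨t * r, ?_⟩
      refine (Set.mem_smul_set_iff_inv_smul_mem₀ ht.ne' _ _).2 ?_
      have hr' : t⁻¹ • (y : E) + r • v ∈ L := hr
      rwa [smul_add, smul_smul, inv_mul_cancel_left₀ ht.ne']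
  have hfin : Module.finrank ℝ (ℝ ∙ v)ᗮ = Module.finrank ℝ E - 1 := by
    rw [← (ℝ ∙ v).finrank_add_finrank_orthogonal, finrank_span_singleton hv0,
      Nat.add_sub_cancel_left]
  rw [h, measureReal_def, Measure.addHaar_smul_of_nonneg _ ht.le, ENNReal.toReal_mul,
    ENNReal.toReal_ofReal (by positivity), hfin]
  rfl

lemma le_measureReal_add_zonotope [Nontrivial E]
    (hC : ∀ v : E, ‖v‖ = 1 → volume.real (shadow v B) = C) {a : E → ℝ}
    (ha : ∀ y, 0 ≤ a y) (s : Finset E) {L : Set E} (hL : IsCompact L) (hc : Convex ℝ L)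
    (hBL : B ⊆ L) :
    volume.real L + 2 * C * ∑ y ∈ s, a y * ‖y‖ ≤ volume.real (L + zonotope s a) := by
  classical
  induction s using Finset.induction_on generalizing L with
  | empty => simp [zonotope]
  | insert y s hy ih =>
    rw [zonotope_insert hy, ← add_assoc, Finset.sum_insert hy]
    refine le_trans ?_ (ih (hL.add (isCompact_symmSegment _)) (hc.add (convex_symmSegment _))
      (hBL.trans (Set.subset_add_left _ (zero_mem_symmSegment _))))
    obtain ⟨v, hv, hav⟩ := exists_unit_smul_eq y (a y)
    have h0 : 0 ≤ a y * ‖y‖ := mul_nonneg (ha y) (norm_nonneg y)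
    rw [hav, measureReal_add_symmSegment hv h0 hL hc]
    have := mul_le_mul_of_nonneg_left (measureReal_shadow_mono hv hL hBL) h0
    rw [hC v hv] at this
    linarith

lemma measureReal_add_zonotope_le [Nontrivial E] (hB : IsCompact B)
    (hC : ∀ v : E, ‖v‖ = 1 → volume.real (shadow v B) = C) {a : E → ℝ}
    (ha : ∀ y, 0 ≤ a y) {t : ℝ} (ht : 0 < t) (s : Finset E) {L : Set E} (hL : IsCompact L)
    (hc : Convex ℝ L) (hBL : L + zonotope s a ⊆ t • B) :
    volume.real (L + zonotope s a) ≤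
      volume.real L + 2 * (t ^ (Module.finrank ℝ E - 1) * C) * ∑ y ∈ s, a y * ‖y‖ := by
  classical
  induction s using Finset.induction_on generalizing L with
  | empty => simp [zonotope]
  | insert y s hy ih =>
    have hLt : L ⊆ t • B := (Set.subset_add_left _ (zero_mem_zonotope _ _)).trans hBL
    rw [zonotope_insert hy, ← add_assoc] at *
    rw [Finset.sum_insert hy]
    refine (ih (hL.add (isCompact_symmSegment _)) (hc.add (convex_symmSegment _)) hBL).trans ?_
    obtain ⟨v, hv, hav⟩ := exists_unit_smul_eq y (a y)
    have h0 : 0 ≤ a y * ‖y‖ := mul_nonneg (ha y) (norm_nonneg y)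
    rw [hav, measureReal_add_symmSegment hv h0 hL hc]
    have := mul_le_mul_of_nonneg_left (measureReal_shadow_mono hv (hB.smul t) hLt) h0
    rw [measureReal_shadow_smul hv ht, hC v hv] at this
    linarith

/-- A first-order comparison of volumes: Minkowski's inequality for mixed volumes where the volume
of the projections of `B` replaces its surface area measure. -/
lemma mixedVolume_le [Nontrivial E] (hB : IsCompact B) (hBc : Convex ℝ B) {r : ℝ} (hr : 0 < r)
    (hrB : closedBall 0 r ⊆ B) (hC : ∀ v : E, ‖v‖ = 1 → volume.real (shadow v B) = C)
    {K : Set E} (hK : IsCompact K) (hKc : Convex ℝ K) (hK0 : 0 ∈ K)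
    (hvol : ∀ ε : ℝ, 0 < ε → (1 + ε) ^ Module.finrank ℝ E * volume.real B ≤
      volume.real (B + ε • K))
    (s : Finset E) {a b : E → ℝ} (ha : ∀ y, 0 ≤ a y) (hb : ∀ y, 0 ≤ b y) {σ : ℝ} (hσ : 0 ≤ σ)
    (h : ∀ z ∈ K, ∀ x, ⟪z, x⟫ + ∑ y ∈ s, a y * |⟪x, y⟫| ≤
      ∑ y ∈ s, b y * |⟪x, y⟫| + σ * suppFun B x) :
    Module.finrank ℝ E * volume.real B + 2 * C * ∑ y ∈ s, a y * ‖y‖ ≤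
      Module.finrank ℝ E * (σ * volume.real B) + 2 * C * ∑ y ∈ s, b y * ‖y‖ := by
  set d := Module.finrank ℝ E
  set V := volume.real B
  set w₁ := ∑ y ∈ s, a y * ‖y‖
  set w₂ := ∑ y ∈ s, b y * ‖y‖ with hw₂
  have hw₂0 : 0 ≤ w₂ := Finset.sum_nonneg fun y _ => mul_nonneg (hb y) (norm_nonneg y)
  have hB0 : (0 : E) ∈ B := hrB (by simp [hr.le])
  have key : ∀ ε : ℝ, 0 < ε → (1 + ε) ^ d * V + 2 * C * (ε * w₁) ≤
      (1 + ε * σ) ^ d * V + 2 * ((1 + ε * (σ + w₂ / r)) ^ (d - 1) * C) * (ε * w₂) := by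
    intro ε hε
    have ha' : ∀ y, 0 ≤ ε * a y := fun y => mul_nonneg hε.le (ha y)
    have hb' : ∀ y, 0 ≤ ε * b y := fun y => mul_nonneg hε.le (hb y)
    have h1 := le_measureReal_add_zonotope hC ha' s (hB.add (hK.smul ε)) (hBc.add (hKc.smul ε))
      (Set.subset_add_left _ ⟨0, hK0, smul_zero ε⟩)
    have hsub : ε • K + zonotope s (fun y => ε * a y) ⊆
        (ε * σ) • B + zonotope s (fun y => ε * b y) := by
      rintro _ ⟨_, ⟨z, hz, rfl⟩, w, hw, rfl⟩
      refine mem_of_forall_exists_inner_le ((hB.smul _).add (isCompact_zonotope _ _))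
        ((hBc.smul _).add (convex_zonotope _ _)) fun x => ?_
      obtain ⟨p, hp, hpx⟩ := exists_inner_eq_suppFun hB ⟨0, hB0⟩ x
      obtain ⟨q, hq, hqx⟩ := exists_mem_zonotope_inner_eq s (fun y => ε * b y) x
      refine ⟨_, ⟨_, ⟨p, hp, rfl⟩, q, hq, rfl⟩, ?_⟩
      have h2 := inner_le_of_mem_zonotope ha' hw x
      have h3 := mul_le_mul_of_nonneg_left (h z hz x) hε.le
      simp only [inner_add_left, inner_smul_left, RCLike.conj_to_real, hpx, hqx]
      simp only [mul_assoc, ← Finset.mul_sum] at h2 h3 ⊢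
      linarith
    have hadd : (1 + ε * σ) • B = B + (ε * σ) • B := by
      rw [hBc.add_smul zero_le_one (by positivity), one_smul]
    have hsub' : B + ε • K + zonotope s (fun y => ε * a y) ⊆
        (1 + ε * σ) • B + zonotope s (fun y => ε * b y) := by
      rw [hadd, add_assoc, add_assoc]
      exact Set.add_subset_add_left hsub
    have hz : zonotope s (fun y => ε * b y) ⊆ (ε * (w₂ / r)) • B := by
      intro z hz
      have h2 := norm_le_of_mem_zonotope hb' hz
      simp only [mul_assoc, ← Finset.mul_sum, ← hw₂] at h2
      rcases hw₂0.eq_or_lt with h0 | h0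
      · rw [← h0, mul_zero] at h2
        rw [norm_le_zero_iff.1 h2]
        exact ⟨0, hB0, smul_zero _⟩
      · rw [Set.mem_smul_set_iff_inv_smul_mem₀ (by positivity)]
        refine hrB ?_
        rw [mem_closedBall_zero_iff, norm_smul, norm_inv, Real.norm_of_nonneg (by positivity),
          inv_mul_le_iff₀ (by positivity)]
        refine h2.trans_eq ?_
        field_simp
    have h4 := measureReal_add_zonotope_le hB hC hb' (t := 1 + ε * (σ + w₂ / r)) (by positivity) s
      (hB.smul (1 + ε * σ)) (hBc.smul _) (by
        rw [mul_add, ← add_assoc, hBc.add_smul (p := 1 + ε * σ) (by positivity) (by positivity)]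
        exact Set.add_subset_add_left hz)
    have h5 := measureReal_mono (μ := volume) hsub'
      ((hB.smul _).add (isCompact_zonotope _ _)).measure_ne_top
    have h6 : volume.real ((1 + ε * σ) • B) = (1 + ε * σ) ^ d * V := by
      rw [measureReal_def, Measure.addHaar_smul_of_nonneg _ (by positivity), ENNReal.toReal_mul,
        ENNReal.toReal_ofReal (by positivity)]
      rfl
    rw [h6] at h4
    simp only [mul_assoc, ← Finset.mul_sum] at h1 h4 ⊢
    linarith [hvol ε hε]
  have hderiv : HasDerivAt (fun ε : ℝ => (1 + ε * σ) ^ d * V +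
      2 * ((1 + ε * (σ + w₂ / r)) ^ (d - 1) * C) * (ε * w₂) -
      ((1 + ε) ^ d * V + 2 * C * (ε * w₁)))
      (d * (σ * V) + 2 * C * w₂ - (d * V + 2 * C * w₁)) 0 := by
    have hid := hasDerivAt_id (0 : ℝ)
    have e1 := (((hid.mul_const σ).const_add 1).pow d).mul_const V
    have e2 := ((((((hid.mul_const (σ + w₂ / r)).const_add 1).pow (d - 1)).mul_const C).const_mul
      2).mul (hid.mul_const w₂))
    have e3 := (((hid.const_add 1).pow d).mul_const V).add ((hid.mul_const w₁).const_mul (2 * C))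
    convert! (e1.add e2).sub e3 using 1
    simp
    ring
  have hlim := hderiv.tendsto_slope_zero_right
  have := ge_of_tendsto hlim (b := 0) (by
    filter_upwards [self_mem_nhdsWithin] with ε hε
    have hε' : 0 < ε := hε
    have := key ε hε'
    simp only [zero_add, smul_eq_mul, zero_mul, add_zero, one_pow, mul_zero, sub_self, sub_zero]
    exact mul_nonneg (by positivity) (by linarith))
  linarith

end MixedVolume

section Steiner

open scoped Pointwise

variable {E : Type*} [NormedAddCommGroup E] [InnerProductSpace ℝ E] {B : Set E} {u : E}

/-- The Steiner symmetral of a convex set with respect to the hyperplane orthogonal to `u`. -/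
noncomputable def steinerSymm (u : E) (B : Set E) : Set E :=
  (fun w : E × E => (1 / 2 : ℝ) • (w.1 + Submodule.reflection (ℝ ∙ u)ᗮ w.2)) ''
    (B ×ˢ B ∩ {w | w.1 - w.2 ∈ ℝ ∙ u})

lemma isCompact_steinerSymm (u : E) (hB : IsCompact B) : IsCompact (steinerSymm u B) := by
  refine ((hB.prod hB).inter_right ?_).image (by fun_prop)
  exact (Submodule.closed_of_finiteDimensional (ℝ ∙ u)).preimage (by fun_prop)

lemma convex_steinerSymm (u : E) (hB : Convex ℝ B) : Convex ℝ (steinerSymm u B) := by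
  let T : E × E →ₗ[ℝ] E := (1 / 2 : ℝ) • (LinearMap.fst ℝ E E +
    (Submodule.reflection (ℝ ∙ u)ᗮ).toLinearEquiv.toLinearMap ∘ₗ LinearMap.snd ℝ E E)
  refine Convex.is_linear_image ?_ T.isLinear
  exact (hB.prod hB).inter ((ℝ ∙ u).convex.linear_preimage
    (LinearMap.fst ℝ E E - LinearMap.snd ℝ E E))

lemma zero_mem_steinerSymm (u : E) (h0 : 0 ∈ B) : 0 ∈ steinerSymm u B :=
  ⟨(0, 0), ⟨⟨h0, h0⟩, by simp⟩, by simp⟩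

lemma steinerSymm_eq_neg (u : E) (h : B = -B) : steinerSymm u B = -steinerSymm u B := by
  have key : ∀ z ∈ steinerSymm u B, -z ∈ steinerSymm u B := by
    rintro _ ⟨⟨p, q⟩, ⟨⟨hp, hq⟩, hpq⟩, rfl⟩
    refine ⟨(-p, -q), ⟨⟨?_, ?_⟩, ?_⟩, ?_⟩
    · rw [h]; simpa using hp
    · rw [h]; simpa using hq
    · have := neg_mem (show p - q ∈ ℝ ∙ u from hpq)
      simpa [neg_add_eq_sub] using this
    · simp only [map_neg]
      module
  ext z
  exact ⟨fun hz => key z hz, fun hz => by simpa using key _ hz⟩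

lemma reflection_add_smul (y : (ℝ ∙ u)ᗮ) (t : ℝ) :
    Submodule.reflection (ℝ ∙ u)ᗮ ((y : E) + t • u) = y - t • u := by
  have h1 : Submodule.reflection (ℝ ∙ u)ᗮ (y : E) = y :=
    Submodule.reflection_mem_subspace_eq_self y.2
  have h2 : Submodule.reflection (ℝ ∙ u)ᗮ u = -u :=
    Submodule.reflection_orthogonalComplement_singleton_eq_neg u
  rw [map_add, map_smul, h1, h2, smul_neg, sub_eq_add_neg]

lemma exists_of_mem_steinerSymm {z : E} (hz : z ∈ steinerSymm u B) : ∃ p ∈ B, ∃ q ∈ B,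
    p - q ∈ ℝ ∙ u ∧
      ∀ x, ⟪z, x⟫ = 1 / 2 * (⟪p, x⟫ + ⟪q, Submodule.reflection (ℝ ∙ u)ᗮ x⟫) := by
  obtain ⟨⟨p, q⟩, ⟨⟨hp, hq⟩, hpq⟩, rfl⟩ := hz
  refine ⟨p, hp, q, hq, hpq, fun x => ?_⟩
  have h := LinearIsometryEquiv.inner_map_map (Submodule.reflection (ℝ ∙ u)ᗮ) q
    (Submodule.reflection (ℝ ∙ u)ᗮ x)
  rw [Submodule.reflection_reflection] at h
  simp only [inner_add_left, inner_smul_left, RCLike.conj_to_real, h]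

lemma suppFun_steinerSymm_le (u : E) (hB : IsCompact B) (hne : (steinerSymm u B).Nonempty) (x : E) :
    suppFun (steinerSymm u B) x ≤
      1 / 2 * (suppFun B x + suppFun B (Submodule.reflection (ℝ ∙ u)ᗮ x)) := by
  obtain ⟨z, hz, hzx⟩ := exists_inner_eq_suppFun (isCompact_steinerSymm u hB) hne x
  obtain ⟨p, hp, q, hq, -, h⟩ := exists_of_mem_steinerSymm hz
  rw [← hzx, h]
  have := inner_le_suppFun hB x hp
  have := inner_le_suppFun hB (Submodule.reflection (ℝ ∙ u)ᗮ x) hq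
  linarith

variable [FiniteDimensional ℝ E] [MeasurableSpace E] [BorelSpace E]

lemma measureReal_smul_le_add_steinerSymm (hu : ‖u‖ = 1) (hB : IsCompact B) (hc : Convex ℝ B)
    {ε : ℝ} (hε : 0 < ε) :
    (1 + ε) ^ Module.finrank ℝ E * volume.real B ≤ volume.real (B + ε • steinerSymm u B) := by
  have hu0 : u ≠ 0 := fun h => by simp [h] at hu
  have hK := isCompact_steinerSymm u hB
  have hL : IsCompact (B + ε • steinerSymm u B) := hB.add (hK.smul ε)
  have hLc : Convex ℝ (B + ε • steinerSymm u B) := hc.add ((convex_steinerSymm u hc).smul ε)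
  have h1 : volume.real ((1 + ε) • B) = (1 + ε) ^ Module.finrank ℝ E * volume.real B := by
    rw [measureReal_def, Measure.addHaar_smul_of_nonneg _ (by positivity), ENNReal.toReal_mul,
      ENNReal.toReal_ofReal (by positivity)]
    rfl
  rw [← h1]
  refine ENNReal.toReal_mono hL.measure_ne_top ?_
  rw [volume_eq_lintegral_lineFiber hu hL.measurableSet,
    volume_eq_lintegral_lineFiber hu (hB.smul _).measurableSet]
  refine lintegral_mono fun y => ?_
  by_cases hy : (lineFiber u ((1 + ε) • B) y).Nonempty
  swap
  · simp [Set.not_nonempty_iff_eq_empty.1 hy]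
  obtain ⟨a, b, hab, h⟩ := exists_lineFiber_eq_Icc hu0 (hB.smul _) (hc.smul _) hy
  have hl : 1 + ε ≠ 0 := by positivity
  have hmem : ∀ t ∈ Set.Icc a b, ((1 + ε)⁻¹ • y : (ℝ ∙ u)ᗮ) + ((1 + ε)⁻¹ * t) • u ∈ B := by
    intro t ht
    rw [← h] at ht
    have := (Set.mem_smul_set_iff_inv_smul_mem₀ hl _ _).1 ht
    simpa [smul_smul] using this
  have hend : ∀ s ∈ Set.Icc a b, ∀ t ∈ Set.Icc a b,
      (1 + ε)⁻¹ * (s + ε * ((s - t) / 2)) ∈ lineFiber u (B + ε • steinerSymm u B) y := by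
    intro s hs t ht
    refine ⟨_, hmem s hs, _, ⟨_, ⟨(_, _), ⟨⟨hmem s hs, hmem t ht⟩, ?_⟩, rfl⟩, rfl⟩, ?_⟩
    · rw [Set.mem_ofPred_eq, add_sub_add_left_eq_sub, ← sub_smul]
      exact Submodule.smul_mem _ _ (Submodule.mem_span_singleton_self u)
    · simp only [reflection_add_smul]
      rw [Submodule.coe_smul]
      match_scalars <;> field_simp <;> ring
  have hsub := (convex_lineFiber u hLc y).ordConnected.out
    (hend a (Set.left_mem_Icc.2 hab) b (Set.right_mem_Icc.2 hab))
    (hend b (Set.right_mem_Icc.2 hab) a (Set.left_mem_Icc.2 hab))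
  refine le_trans (le_of_eq ?_) (measure_mono hsub)
  rw [h, Real.volume_Icc, Real.volume_Icc]
  congr 1
  field_simp
  ring

end Steiner

section Rigidity

open scoped Pointwise Topology

variable {E : Type*} [NormedAddCommGroup E] [InnerProductSpace ℝ E] {B : Set E} {C r : ℝ}

lemma mul_norm_le_suppFun (hB : IsCompact B) (hr : 0 < r) (hrB : closedBall 0 r ⊆ B) (x : E) :
    r * ‖x‖ ≤ suppFun B x := by
  rcases eq_or_ne x 0 with rfl | hx
  · simpa using suppFun_smul B le_rfl (0 : E) |>.ge
  · have hx' : ‖x‖ ≠ 0 := norm_ne_zero_iff.2 hx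
    refine le_trans (le_of_eq ?_) (inner_le_suppFun hB x (p := (r / ‖x‖) • x) (hrB ?_))
    · rw [inner_smul_left, real_inner_self_eq_norm_sq, RCLike.conj_to_real]
      field_simp
    · rw [mem_closedBall_zero_iff, norm_smul, norm_div, norm_norm, div_mul_cancel₀ _ hx',
        Real.norm_of_nonneg hr.le]

section Measure

variable [FiniteDimensional ℝ E] [MeasurableSpace E] [BorelSpace E]

lemma integral_suppFun_le [Nontrivial E] (hB : IsCompact B) (hBc : Convex ℝ B) (hBs : B = -B)
    (hr : 0 < r) (hrB : closedBall 0 r ⊆ B)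
    (hC : ∀ v : E, ‖v‖ = 1 → volume.real (shadow v B) = C)
    {K : Set E} (hK : IsCompact K) (hKc : Convex ℝ K) (hKs : K = -K) (hK0 : 0 ∈ K)
    (hvol : ∀ ε : ℝ, 0 < ε → (1 + ε) ^ Module.finrank ℝ E * volume.real B ≤
      volume.real (B + ε • K)) :
    ∫ x in ball (0 : E) 1, (suppFun B x - suppFun K x) ≤ 0 := by
  obtain ⟨κ, hκ, hint⟩ := exists_integral_abs_inner (E := E)
  have hCpos : 0 < C := by
    obtain ⟨e, he⟩ := exists_norm_eq E zero_le_one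
    rw [← hC e he]
    refine lt_of_lt_of_le ?_ (measureReal_mono (s₁ := ball 0 r) ?_
      (isCompact_shadow he hB).measure_ne_top)
    · exact ENNReal.toReal_pos (measure_ball_pos _ _ hr).ne' measure_ball_lt_top.ne
    · intro y hy
      refine ⟨0, hrB ?_⟩
      simpa using (mem_ball_zero_iff.1 hy).le
  have hi : ∀ {g : E → ℝ}, Continuous g → IntegrableOn g (ball 0 1) volume := fun hg =>
    (hg.continuousOn.integrableOn_compact (isCompact_closedBall 0 1)).mono_set ball_subset_closedBall
  set f : E → ℝ := fun x => suppFun B x - suppFun K x with hf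
  have hfc : Continuous f := (continuous_suppFun hB).sub (continuous_suppFun hK)
  set V := volume.real B
  set d := Module.finrank ℝ E
  set I := ∫ x in ball (0 : E) 1, ‖x‖
  have hI : 0 ≤ I := integral_nonneg fun _ => norm_nonneg _
  have key : ∀ η : ℝ, 0 < η → ∫ x in ball (0 : E) 1, f x ≤ η * (I + κ * (d * V / (2 * C * r))) := by
    intro η hη
    obtain ⟨s, a, ha⟩ := exists_sum_abs_inner_near f hfc
      (fun x => by simp only [hf, suppFun_neg hBs, suppFun_neg hKs])
      (fun t x ht => by simp only [hf, suppFun_smul _ ht]; ring) hη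
    have hsplit : ∀ g : E → ℝ, ∑ y ∈ s, max (a y) 0 * g y - ∑ y ∈ s, max (-a y) 0 * g y =
        ∑ y ∈ s, a y * g y := fun g => by
      rw [← Finset.sum_sub_distrib]
      refine Finset.sum_congr rfl fun y _ => ?_
      rw [← sub_mul, max_zero_sub_max_neg_zero_eq_self]
    have hmv := mixedVolume_le hB hBc hr hrB hC hK hKc hK0 hvol s
      (a := fun y => max (a y) 0) (b := fun y => max (-a y) 0) (σ := 1 + η / r)
      (fun _ => le_max_right _ _) (fun _ => le_max_right _ _) (by positivity) (fun z hz x => by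
        have h1 := inner_le_suppFun hK x hz
        have h2 := (abs_le.1 (ha x)).1
        have h3 := hsplit fun y => |⟪x, y⟫|
        have h4 : η * ‖x‖ ≤ η / r * suppFun B x := by
          rw [div_mul_eq_mul_div, le_div_iff₀ hr]
          have := mul_le_mul_of_nonneg_left (mul_norm_le_suppFun hB hr hrB x) hη.le
          linarith
        simp only [hf] at h2
        linarith)
    have h3 := hsplit fun y => ‖y‖
    have h5 : 2 * C * ∑ y ∈ s, a y * ‖y‖ ≤ η * (d * V / r) := by
      have : η * (d * V / r) = d * ((1 + η / r) * V) - d * V := by field_simp; ring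
      rw [this, ← h3]
      linarith
    have h6 : ∑ y ∈ s, a y * ‖y‖ ≤ η * (d * V / (2 * C * r)) := by
      have : η * (d * V / (2 * C * r)) = η * (d * V / r) / (2 * C) := by field_simp
      rwa [this, le_div_iff₀' (by positivity)]
    have h7 : ∫ x in ball (0 : E) 1, ∑ y ∈ s, a y * |⟪x, y⟫| = κ * ∑ y ∈ s, a y * ‖y‖ := by
      rw [integral_finsetSum _ fun y _ => hi (by fun_prop), Finset.mul_sum]
      refine Finset.sum_congr rfl fun y _ => ?_
      rw [integral_const_mul]
      simp_rw [real_inner_comm y, hint]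
      ring
    calc ∫ x in ball (0 : E) 1, f x
        ≤ ∫ x in ball (0 : E) 1, (η * ‖x‖ + ∑ y ∈ s, a y * |⟪x, y⟫|) := by
          refine integral_mono (hi hfc) (hi (by fun_prop)) fun x => ?_
          have := (abs_le.1 (ha x)).2
          simp only
          linarith
      _ = η * I + κ * ∑ y ∈ s, a y * ‖y‖ := by
          rw [integral_add (hi (by fun_prop)) (hi (by fun_prop)), integral_const_mul, h7]
      _ ≤ _ := by
          have := mul_le_mul_of_nonneg_left h6 hκ.le
          linarith
  have hM : 0 ≤ I + κ * (d * V / (2 * C * r)) := by positivity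
  refine le_of_forall_pos_le_add fun δ hδ => ?_
  refine (key (δ / (I + κ * (d * V / (2 * C * r)) + 1)) (by positivity)).trans ?_
  rw [zero_add, div_mul_eq_mul_div, div_le_iff₀ (by positivity)]
  nlinarith

/-- If all shadows of `B` have the same volume, then points of any two faces of `B` whose outer
normals are `θ₁` and `θ₂` are joined by a chord parallel to `θ₁ - θ₂`. -/
lemma exists_faces [Nontrivial E] (hB : IsCompact B) (hBc : Convex ℝ B) (hBs : B = -B)
    (hr : 0 < r) (hrB : closedBall 0 r ⊆ B)
    (hC : ∀ v : E, ‖v‖ = 1 → volume.real (shadow v B) = C) {θ₁ θ₂ : E} (h₁ : ‖θ₁‖ = 1)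
    (h₂ : ‖θ₂‖ = 1) :
    ∃ p ∈ B, ∃ q ∈ B, ∃ m : ℝ, p - q = m • (θ₁ - θ₂) ∧ ⟪p, θ₁⟫ = suppFun B θ₁ ∧
      ⟪q, θ₂⟫ = suppFun B θ₂ := by
  have hB0 : (0 : E) ∈ B := hrB (by simp [hr.le])
  rcases eq_or_ne θ₁ θ₂ with rfl | hne
  · obtain ⟨p, hp, h⟩ := exists_inner_eq_suppFun hB ⟨0, hB0⟩ θ₁
    exact ⟨p, hp, p, hp, 0, by simp, h, h⟩
  have hsub : θ₁ - θ₂ ≠ 0 := sub_ne_zero.2 hne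
  set u := ‖θ₁ - θ₂‖⁻¹ • (θ₁ - θ₂) with hu_def
  have hu : ‖u‖ = 1 := by
    rw [hu_def, norm_smul, norm_inv, norm_norm, inv_mul_cancel₀ (norm_ne_zero_iff.2 hsub)]
  have hspan : ℝ ∙ u = ℝ ∙ (θ₁ - θ₂) :=
    Submodule.span_singleton_smul_eq (IsUnit.mk0 _ (inv_ne_zero (norm_ne_zero_iff.2 hsub))) _
  have hrefl : Submodule.reflection (ℝ ∙ u)ᗮ θ₁ = θ₂ := by
    rw [← Submodule.reflection_sub (h₁.trans h₂.symm)]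
    congr 2
    rw [hspan]
  set K := steinerSymm u B with hKdef
  have hK : IsCompact K := isCompact_steinerSymm u hB
  have hK0 : 0 ∈ K := zero_mem_steinerSymm u hB0
  have hint := integral_suppFun_le hB hBc hBs hr hrB hC hK (convex_steinerSymm u hBc)
    (steinerSymm_eq_neg u hBs) hK0 fun ε hε => measureReal_smul_le_add_steinerSymm hu hB hBc hε
  have hi : ∀ {g : E → ℝ}, Continuous g → IntegrableOn g (ball 0 1) volume := fun hg =>
    (hg.continuousOn.integrableOn_compact (isCompact_closedBall 0 1)).mono_set ball_subset_closedBall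
  have hcB := continuous_suppFun hB
  have hcK := continuous_suppFun hK
  have hcR : Continuous fun x => suppFun B (Submodule.reflection (ℝ ∙ u)ᗮ x) := by fun_prop
  have hzero := eqOn_zero_of_integral_ball_nonpos volume
    (g := fun x => 1 / 2 * (suppFun B x + suppFun B (Submodule.reflection (ℝ ∙ u)ᗮ x)) -
      suppFun K x) (by fun_prop)
    (fun x => sub_nonneg.2 (suppFun_steinerSymm_le u hB ⟨0, hK0⟩ x)) (by
      rw [integral_sub (hi hcB) (hi hcK)] at hint
      rw [integral_sub (hi (by fun_prop)) (hi hcK), integral_const_mul,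
        integral_add (hi hcB) (hi hcR), integral_ball_comp_linearIsometryEquiv _ (suppFun B)]
      linarith) ((1 / 2 : ℝ) • θ₁) (by simp [norm_smul, h₁]; norm_num)
  simp only [map_smul, hrefl, suppFun_smul _ (show (0 : ℝ) ≤ 1 / 2 by norm_num)] at hzero
  obtain ⟨z, hz, hzx⟩ := exists_inner_eq_suppFun hK ⟨0, hK0⟩ θ₁
  obtain ⟨p, hp, q, hq, hpq, h⟩ := exists_of_mem_steinerSymm hz
  rw [hspan] at hpq
  obtain ⟨m, hm⟩ := Submodule.mem_span_singleton.1 hpq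
  have h3 := h θ₁
  rw [hrefl] at h3
  have h4 := inner_le_suppFun hB θ₁ hp
  have h5 := inner_le_suppFun hB θ₂ hq
  exact ⟨p, hp, q, hq, m, hm.symm, by linarith, by linarith⟩

end Measure

lemma eq_smul_of_inner_ge {p θ : E} {R : ℝ} (hθ : ‖θ‖ = 1) (hp : ‖p‖ ≤ R)
    (h : R ≤ ⟪p, θ⟫) : p = R • θ := by
  have hR : 0 ≤ R := (norm_nonneg p).trans hp
  rw [← sub_eq_zero, ← norm_eq_zero, ← sq_eq_zero_iff]
  refine le_antisymm ?_ (sq_nonneg _)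
  rw [norm_sub_sq_real, inner_smul_right, norm_smul, hθ, Real.norm_of_nonneg hR]
  nlinarith [norm_nonneg p]

lemma eq_closedBall_of_faces [Nontrivial E] (hB : IsCompact B) (hBc : Convex ℝ B) (hBs : B = -B)
    (hr : 0 < r) (hrB : closedBall 0 r ⊆ B)
    (hF : ∀ θ₁ θ₂ : E, ‖θ₁‖ = 1 → ‖θ₂‖ = 1 → ∃ p ∈ B, ∃ q ∈ B, ∃ m : ℝ, p - q = m • (θ₁ - θ₂) ∧
      ⟪p, θ₁⟫ = suppFun B θ₁ ∧ ⟪q, θ₂⟫ = suppFun B θ₂) :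
    ∃ R : ℝ, 0 < R ∧ B = closedBall 0 R := by
  have hB0 : (0 : E) ∈ B := hrB (by simp [hr.le])
  obtain ⟨p₀, hp₀, hmax⟩ := hB.exists_isMaxOn ⟨0, hB0⟩ continuous_norm.continuousOn
  set R := ‖p₀‖ with hR
  have hBR : ∀ p ∈ B, ‖p‖ ≤ R := fun p hp => hmax hp
  have hRpos : 0 < R := by
    obtain ⟨e, he⟩ := exists_norm_eq E hr.le
    exact hr.trans_le (he ▸ hBR e (hrB (by simp [he])))
  have hle : ∀ θ : E, ‖θ‖ = 1 → suppFun B θ ≤ R := fun θ hθ => by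
    obtain ⟨p, hp, h⟩ := exists_inner_eq_suppFun hB ⟨0, hB0⟩ θ
    rw [← h]
    exact (real_inner_le_norm p θ).trans (by simpa [hθ] using hBR p hp)
  set θ₀ := R⁻¹ • p₀ with hθ₀
  have hn₀ : ‖θ₀‖ = 1 := by
    rw [hθ₀, norm_smul, norm_inv, Real.norm_of_nonneg hRpos.le, ← hR, inv_mul_cancel₀ hRpos.ne']
  have hs₀ : suppFun B θ₀ = R := by
    refine le_antisymm (hle _ hn₀) (le_trans (le_of_eq ?_) (inner_le_suppFun hB θ₀ hp₀))
    rw [hθ₀, inner_smul_right, real_inner_self_eq_norm_sq, ← hR]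
    field_simp
  have hA : ∀ θ : E, ‖θ‖ = 1 → ∃ q ∈ B, ⟪q, θ⟫ = suppFun B θ ∧
      ⟪q, θ₀⟫ = R - suppFun B θ + R * ⟪θ₀, θ⟫ := by
    intro θ hθ
    obtain ⟨p, hp, q, hq, m, hm, h1, h2⟩ := hF θ₀ θ hn₀ hθ
    obtain rfl := eq_smul_of_inner_ge hn₀ (hBR p hp) (h1.trans hs₀).ge
    refine ⟨q, hq, h2, ?_⟩
    have e1 := congrArg (fun x => ⟪x, θ₀⟫) hm
    have e2 := congrArg (fun x => ⟪x, θ⟫) hm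
    simp only [inner_sub_left, inner_smul_left, RCLike.conj_to_real, real_inner_self_eq_norm_sq,
      hn₀, hθ, real_inner_comm θ₀ θ, h2] at e1 e2
    linarith
  have hA' : ∀ θ : E, ‖θ‖ = 1 → ∃ q ∈ B, ⟪q, θ⟫ = suppFun B θ ∧
      ⟪q, θ₀⟫ = suppFun B θ - R + R * ⟪θ₀, θ⟫ := by
    intro θ hθ
    obtain ⟨p, hp, q, hq, m, hm, h1, h2⟩ := hF (-θ₀) θ (by rwa [norm_neg]) hθ
    obtain rfl := eq_smul_of_inner_ge (by rwa [norm_neg]) (hBR p hp)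
      (h1.trans ((suppFun_neg hBs _).trans hs₀)).ge
    refine ⟨q, hq, h2, ?_⟩
    have e1 := congrArg (fun x => ⟪x, θ₀⟫) hm
    have e2 := congrArg (fun x => ⟪x, θ⟫) hm
    simp only [inner_sub_left, inner_smul_left, RCLike.conj_to_real, real_inner_self_eq_norm_sq,
      inner_neg_left, hn₀, hθ, real_inner_comm θ₀ θ, h2] at e1 e2
    linarith
  have hconst : ∀ θ : E, ‖θ‖ = 1 → suppFun B θ = R := by
    intro θ hθ
    refine le_antisymm (hle θ hθ) ?_
    obtain ⟨q₁, hq₁, h1, h1'⟩ := hA θ hθ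
    have hbound : ∀ᶠ t : ℝ in 𝓝[>] 0,
        R - suppFun B θ + R * ⟪θ₀, θ⟫ ≤ R * (‖θ + t • θ₀‖⁻¹ * (⟪θ₀, θ⟫ + t)) := by
      filter_upwards [Ioo_mem_nhdsGT zero_lt_one] with t ht
      set ξ := θ + t • θ₀ with hξ
      have hξpos : 0 < ‖ξ‖ := by
        have := norm_sub_norm_le θ (-(t • θ₀))
        rw [sub_neg_eq_add, norm_neg, norm_smul, hθ, hn₀, Real.norm_of_nonneg ht.1.le] at this
        linarith [ht.2]
      obtain ⟨q₂, hq₂, h2, h2'⟩ := hA' (‖ξ‖⁻¹ • ξ) (by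
        rw [norm_smul, norm_inv, norm_norm, inv_mul_cancel₀ hξpos.ne'])
      have hle2 := hle (‖ξ‖⁻¹ • ξ) (by
        rw [norm_smul, norm_inv, norm_norm, inv_mul_cancel₀ hξpos.ne'])
      have e1 : ⟪q₂, θ⟫ ≤ ⟪q₁, θ⟫ := h1 ▸ inner_le_suppFun hB θ hq₂
      have e2 : ⟪q₁, ξ⟫ ≤ ⟪q₂, ξ⟫ := by
        rw [inner_smul_right] at h2
        have := inner_le_suppFun hB (‖ξ‖⁻¹ • ξ) hq₁
        rw [← h2, inner_smul_right] at this
        exact le_of_mul_le_mul_left this (inv_pos.2 hξpos)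
      rw [hξ, inner_add_right, inner_add_right, real_inner_smul_right q₁ θ₀,
        real_inner_smul_right q₂ θ₀] at e2
      have e3 : ⟪q₁, θ₀⟫ ≤ ⟪q₂, θ₀⟫ := le_of_mul_le_mul_left (by linarith) ht.1
      have e4 : ⟪θ₀, ‖ξ‖⁻¹ • ξ⟫ = ‖ξ‖⁻¹ * (⟪θ₀, θ⟫ + t) := by
        rw [inner_smul_right, hξ, inner_add_right, inner_smul_right, real_inner_self_eq_norm_sq,
          hn₀]
        ring
      rw [e4] at h2'
      linarith
    have hlim : Filter.Tendsto (fun t : ℝ => R * (‖θ + t • θ₀‖⁻¹ * (⟪θ₀, θ⟫ + t))) (𝓝[>] 0)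
        (𝓝 (R * ⟪θ₀, θ⟫)) := by
      have : ContinuousAt (fun t : ℝ => R * (‖θ + t • θ₀‖⁻¹ * (⟪θ₀, θ⟫ + t))) 0 := by
        refine continuousAt_const.mul (ContinuousAt.mul (ContinuousAt.inv₀ ?_ ?_) ?_)
        · fun_prop
        · simp [hθ]
        · fun_prop
      have h := this.tendsto.mono_left (nhdsWithin_le_nhds (s := Set.Ioi 0))
      simpa [hθ] using h
    linarith [ge_of_tendsto hlim hbound]
  refine ⟨R, hRpos, Set.Subset.antisymm (fun p hp => by simpa using hBR p hp) fun x hx => ?_⟩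
  rcases eq_or_ne x 0 with rfl | hx0
  · exact hB0
  have hx' : 0 < ‖x‖ := norm_pos_iff.2 hx0
  have hθ : ‖‖x‖⁻¹ • x‖ = 1 := by
    rw [norm_smul, norm_inv, norm_norm, inv_mul_cancel₀ hx'.ne']
  obtain ⟨q, hq, h⟩ := exists_inner_eq_suppFun hB ⟨0, hB0⟩ (‖x‖⁻¹ • x)
  obtain rfl := eq_smul_of_inner_ge hθ (hBR q hq) (h.trans (hconst _ hθ)).ge
  have := hBc.smul_mem_of_zero_mem hB0 hq (t := ‖x‖ / R)
    ⟨by positivity, (div_le_one hRpos).2 (by simpa using hx)⟩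
  convert this using 1
  rw [smul_smul, smul_smul]
  field_simp
  simp

end Rigidity

/-- Aleksandrov's projection theorem: if all orthogonal projections onto
linear hyperplanes of a symmetric convex body `B ⊆ ℝ^{n+1}` have the same `n`-dimensional
volume, then `B` is a ball centered at the origin.  For a unit vector `v`, the orthogonal
projection onto the hyperplane `v^⊥` is the map `x ↦ x - ⟪x, v⟫ v`. -/
theorem aleksandrov_projection_theorem
    (n : ℕ) (hn : 2 ≤ n)
    (B : Set (EuclideanSpace ℝ (Fin (n + 1))))
    (hBcompact : IsCompact B) (hBconv : Convex ℝ B) (hBint : (interior B).Nonempty)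
    (hBsym : B = -B)
    (c : ℝ≥0∞)
    (hproj : ∀ v : EuclideanSpace ℝ (Fin (n + 1)), ‖v‖ = 1 →
      μH[(n : ℝ)] ((fun x => x - ⟪x, v⟫ • v) '' B) = c) :
    ∃ r : ℝ, 0 < r ∧ B = closedBall 0 r := by
  obtain ⟨x, hx⟩ := hBint
  have h0 : (0 : EuclideanSpace ℝ (Fin (n + 1))) ∈ interior B := by
    have hx' : -x ∈ B := by
      rw [hBsym]
      simpa using interior_subset hx
    have := hBconv.combo_interior_self_mem_interior hx hx' (a := 1 / 2) (b := 1 / 2)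
      (by norm_num) (by norm_num) (by norm_num)
    simpa using this
  obtain ⟨r, hr, hrB⟩ := Metric.nhds_basis_closedBall.mem_iff.1 (mem_interior_iff_mem_nhds.1 h0)
  refine eq_closedBall_of_faces hBcompact hBconv hBsym hr hrB fun θ₁ θ₂ h₁ h₂ =>
    exists_faces hBcompact hBconv hBsym hr hrB (C := (Measure.addHaarScalarFactor
      (volume : Measure (EuclideanSpace ℝ (Fin n))) μH[n] * c).toReal) (fun v hv => ?_) h₁ h₂
  rw [measureReal_def, volume_shadow finrank_euclideanSpace_fin hv,
    Measure.euclideanHausdorffMeasure_def, Measure.smul_apply, hproj v hv]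
  rfl
end
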